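/- Assume Hypothesis A and that φ is twice continuously differentiable. Then the regularized vortex filament evolution has a unique global solution for every initial datum in H¹: for every closed curve γ₀ : [0,1] → ℝ³ with γ₀(0) = γ₀(1), absolutely continuous with derivative γ₀' ∈ L²((0,1); ℝ³), there exists a unique γ : [0,∞) × [0,1] → ℝ³ such that for every t ≥ 0 the curve γ(t,·) is closed, absolutely continuous with derivative in L²((0,1); ℝ³) and bounded in that norm uniformly on compact time intervals, t ↦ γ(t,·) is Lipschitz from compact intervals into L²((0,1); ℝ³), and γ(t,ξ) = γ₀(ξ) + ∫₀ᵗ ∫₀¹ ∇φ(γ(τ,ξ) − γ(τ,η)) ∧ ∂_ηγ(τ,η) dη dτ for all t ≥ 0 and a.e. ξ ∈ [0,1]. -/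

import Mathlib

noncomputable section
open MeasureTheory Real Set

/-- Three-dimensional Euclidean space. -/
abbrev E3 := EuclideanSpace ℝ (Fin 3)

/-- The Fourier transform `∫_{ℝ³} e^{i⟨k,x⟩} f(x) dx` of `f : ℝ³ → ℝ`, as a complex number. -/
def fourierInt (f : E3 → ℝ) (k : E3) : ℂ :=
  ∫ x : E3, Complex.exp (Complex.I * ((inner ℝ k x : ℝ) : ℂ)) * (f x : ℂ)

/-- Hypothesis A: `φ` is even, continuous, integrable, its Fourier transform is the real
nonnegative function `φhat`, and `φhat` satisfies the moment condition (A.4). -/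
structure HypA (φ : E3 → ℝ) (φhat : E3 → ℝ) : Prop where
  even : ∀ x, φ (-x) = φ x
  cont : Continuous φ
  integrable : Integrable φ
  fourier_eq : ∀ k, (φhat k : ℂ) = fourierInt φ k
  nonneg : ∀ k, 0 ≤ φhat k
  moment : Integrable (fun k : E3 => (1 + ‖k‖ ^ 2) ^ 2 * φhat k)

/-- `γ : [0,1] → ℝ³` is a closed curve, absolutely continuous with derivative `γd`
belonging to `L²((0,1); ℝ³)`. -/
structure IsH1Loop (γ γd : ℝ → E3) : Prop where
  closed : γ 0 = γ 1
  deriv_eq : ∀ ξ ∈ Icc (0:ℝ) 1, γ ξ = γ 0 + ∫ s in (0:ℝ)..ξ, γd s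
  memL2 : MemLp γd 2 (volume.restrict (Ioc (0:ℝ) 1))

/-- The kinetic energy `H(γ) = (1/2)∫₀¹∫₀¹ φ(γ(ξ)-γ(η)) ⟨γ'(ξ), γ'(η)⟩ dξ dη`. -/
def energy (φ : E3 → ℝ) (γ γd : ℝ → E3) : ℝ :=
  (1 / 2) * ∫ ξ in (0:ℝ)..1, ∫ η in (0:ℝ)..1, φ (γ ξ - γ η) * (inner ℝ (γd ξ) (γd η) : ℝ)

/-- The cross product on `ℝ³`. -/
def cross3 (a b : E3) : E3 := WithLp.toLp 2 (crossProduct a.ofLp b.ofLp)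

/-- The induced velocity `u(x) = ∫₀¹ ∇φ(x - γ(ξ)) ∧ γ'(ξ) dξ`. -/
def velocity (φ : E3 → ℝ) (γ γd : ℝ → E3) (x : E3) : E3 :=
  ∫ ξ in (0:ℝ)..1, cross3 (gradient φ (x - γ ξ)) (γd ξ)

/-- `γ` is a global strong solution of the regularized vortex filament evolution
with kernel `φ` and initial datum `γ₀`: for each `t ≥ 0`, `γ(t,·)` is a closed `H¹`
curve with derivative `γd(t,·)`, the `L²` norms of the derivatives are bounded on
compact time intervals, `t ↦ γ(t,·)` is Lipschitz from compact intervals into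
`L²(0,1)`, and the integral form of the equation holds for a.e. `ξ ∈ [0,1]`. -/
def IsGlobalFilamentSolution (φ : E3 → ℝ) (γ₀ : ℝ → E3) (γ : ℝ → ℝ → E3) : Prop :=
  ∃ γd : ℝ → ℝ → E3,
    (∀ t : ℝ, 0 ≤ t → IsH1Loop (γ t) (γd t)) ∧
    (∀ T : ℝ, 0 ≤ T → ∃ M : ℝ, ∀ t ∈ Icc (0:ℝ) T,
      (∫ ξ in Ioc (0:ℝ) 1, ‖γd t ξ‖ ^ 2) ≤ M) ∧
    (∀ T : ℝ, 0 ≤ T → ∃ K : ℝ, ∀ s ∈ Icc (0:ℝ) T, ∀ t ∈ Icc (0:ℝ) T,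
      Real.sqrt (∫ ξ in Ioc (0:ℝ) 1, ‖γ t ξ - γ s ξ‖ ^ 2) ≤ K * |t - s|) ∧
    (∀ t : ℝ, 0 ≤ t → ∀ᵐ ξ ∂(volume.restrict (Ioc (0:ℝ) 1)),
      γ t ξ = γ₀ ξ +
        ∫ τ in (0:ℝ)..t, ∫ η in (0:ℝ)..1,
          cross3 (gradient φ (γ τ ξ - γ τ η)) (γd τ η))

open scoped FourierTransform BoundedContinuousFunction

/-- The cross product of `ℝ³` as a continuous bilinear map. -/
def crossL : E3 →L[ℝ] E3 →L[ℝ] E3 :=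
  LinearMap.toContinuousLinearMap
    ((LinearMap.toContinuousLinearMap (𝕜 := ℝ) (E := E3) (F' := E3)).toLinearMap ∘ₗ
      LinearMap.mk₂ ℝ cross3
        (by intro a b c; simp [cross3])
        (by intro a b c; simp [cross3])
        (by intro a b c; simp [cross3])
        (by intro a b c; simp [cross3]))

lemma crossL_apply (a b : E3) : crossL a b = cross3 a b := rfl

lemma inner_eq_sum3 (a b : E3) : inner ℝ a b = a 0 * b 0 + a 1 * b 1 + a 2 * b 2 := by
  simp [PiLp.inner_apply, Fin.sum_univ_three, mul_comm]

lemma inner_cross3_cross3 (a b c d : E3) :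
    inner ℝ (cross3 a b) (cross3 c d) =
      inner ℝ a c * inner ℝ b d - inner ℝ a d * inner ℝ b c := by
  simp only [inner_eq_sum3, cross3, cross_apply]
  simp
  ring

lemma norm_cross3_le (a b : E3) : ‖cross3 a b‖ ≤ ‖a‖ * ‖b‖ := by
  have h := inner_cross3_cross3 a b a b
  rw [real_inner_self_eq_norm_sq, real_inner_self_eq_norm_sq, real_inner_self_eq_norm_sq,
    real_inner_comm a b] at h
  refine abs_le_of_sq_le_sq' ?_ (by positivity) |>.2
  nlinarith [sq_nonneg (inner ℝ a b)]

lemma norm_crossL_le (a : E3) : ‖crossL a‖ ≤ ‖a‖ :=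
  (crossL a).opNorm_le_bound (norm_nonneg _) (norm_cross3_le a)

/-- A function whose increments are dominated by those of an absolutely continuous function is
absolutely continuous. -/
lemma AbsolutelyContinuousOnInterval.of_dist_le {X Z : Type*} [PseudoMetricSpace X]
    [PseudoMetricSpace Z] {f : ℝ → X} {g : ℝ → Z} {a b C : ℝ}
    (hg : AbsolutelyContinuousOnInterval g a b)
    (h : ∀ x ∈ uIcc a b, ∀ y ∈ uIcc a b, dist (f x) (f y) ≤ C * dist (g x) (g y)) :
    AbsolutelyContinuousOnInterval f a b := by
  rw [absolutelyContinuousOnInterval_iff] at hg ⊢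
  intro ε hε
  have hC : 0 < |C| + 1 := by positivity
  obtain ⟨δ, hδ, H⟩ := hg (ε / (|C| + 1)) (by positivity)
  refine ⟨δ, hδ, fun P hP hPδ => ?_⟩
  calc ∑ i ∈ Finset.range P.1, dist (f (P.2 i).1) (f (P.2 i).2)
      ≤ ∑ i ∈ Finset.range P.1, (|C| + 1) * dist (g (P.2 i).1) (g (P.2 i).2) := by
        refine Finset.sum_le_sum fun i hi => ?_
        refine (h _ (hP.1 i hi).1 _ (hP.1 i hi).2).trans ?_
        gcongr
        linarith [le_abs_self C]
    _ = (|C| + 1) * ∑ i ∈ Finset.range P.1, dist (g (P.2 i).1) (g (P.2 i).2) := by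
        rw [Finset.mul_sum]
    _ < (|C| + 1) * (ε / (|C| + 1)) := by gcongr; exact H P hP hPδ
    _ = ε := by field_simp

lemma continuousOn_of_eq_add_integral {E : Type*} [NormedAddCommGroup E] [NormedSpace ℝ E]
    {γ v : ℝ → E} (hv : IntervalIntegrable v volume 0 1)
    (hγ : ∀ ξ ∈ Icc (0:ℝ) 1, γ ξ = γ 0 + ∫ s in (0:ℝ)..ξ, v s) :
    ContinuousOn γ (Icc 0 1) := by
  refine ContinuousOn.congr (f := fun ξ => γ 0 + ∫ s in (0:ℝ)..ξ, v s) ?_ hγ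
  have h := intervalIntegral.continuousOn_primitive_interval (μ := volume) (a := 0) (b := 1)
    (f := v) (by
      rw [uIcc_of_le zero_le_one]
      exact (intervalIntegrable_iff_integrableOn_Icc_of_le zero_le_one).1 hv)
  rw [uIcc_of_le zero_le_one] at h
  exact continuousOn_const.add h

/-- The pointwise application of a continuous operator field to an integrable field is
integrable. -/
lemma ContinuousOn.intervalIntegrable_clm_apply {E E' : Type*} [NormedAddCommGroup E]
    [NormedSpace ℝ E] [NormedAddCommGroup E'] [NormedSpace ℝ E']
    {A : ℝ → E →L[ℝ] E'} {v : ℝ → E} (hA : ContinuousOn A (Icc 0 1))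
    (hv : IntervalIntegrable v volume 0 1) :
    IntervalIntegrable (fun s => A s (v s)) volume 0 1 := by
  obtain ⟨C, hC⟩ := isCompact_Icc.exists_bound_of_continuousOn hA
  have hA' : AEStronglyMeasurable A (volume.restrict (Ioc 0 1)) :=
    (hA.mono Ioc_subset_Icc_self).aestronglyMeasurable measurableSet_Ioc
  rw [intervalIntegrable_iff_integrableOn_Ioc_of_le zero_le_one] at hv ⊢
  refine Integrable.mono' (hv.norm.const_mul C)
    ((ContinuousLinearMap.apply ℝ E').flip.aestronglyMeasurable_comp₂ hA' hv.1) ?_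
  filter_upwards [ae_restrict_mem measurableSet_Ioc] with s hs
  exact ((A s).le_opNorm _).trans (by gcongr; exact hC s (Ioc_subset_Icc_self hs))

/-- The chain rule for a `C¹` function along an absolutely continuous curve. -/
lemma comp_eq_add_integral_of_eq_add_integral {E E' : Type*} [NormedAddCommGroup E]
    [NormedSpace ℝ E] [FiniteDimensional ℝ E] [NormedAddCommGroup E'] [NormedSpace ℝ E']
    [FiniteDimensional ℝ E']
    {F : E → E'} {F' : E → E →L[ℝ] E'} (hF : ∀ x, HasFDerivAt F (F' x) x) (hF' : Continuous F')
    {γ v : ℝ → E} (hv : IntervalIntegrable v volume 0 1)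
    (hγ : ∀ ξ ∈ Icc (0:ℝ) 1, γ ξ = γ 0 + ∫ s in (0:ℝ)..ξ, v s)
    {ξ : ℝ} (hξ : ξ ∈ Icc (0:ℝ) 1) :
    F (γ ξ) = F (γ 0) + ∫ s in (0:ℝ)..ξ, F' (γ s) (v s) := by
  have : CompleteSpace E := FiniteDimensional.complete ℝ E
  have : CompleteSpace E' := FiniteDimensional.complete ℝ E'
  have : ProperSpace E := FiniteDimensional.proper_real E
  have hγc := continuousOn_of_eq_add_integral hv hγ
  have hw : IntervalIntegrable (fun s => F' (γ s) (v s)) volume 0 1 :=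
    (hF'.comp_continuousOn hγc).intervalIntegrable_clm_apply hv
  obtain ⟨R, hR⟩ := isCompact_Icc.exists_bound_of_continuousOn hγc
  obtain ⟨C, hC⟩ := (isCompact_closedBall (0:E) R).exists_bound_of_continuousOn hF'.continuousOn
  have hC0 : 0 ≤ C := (norm_nonneg _).trans (hC (γ 0) (by simpa using hR 0 (by simp)))
  have hsub : ∀ {x y : ℝ}, x ∈ Icc (0:ℝ) 1 → y ∈ Icc (0:ℝ) 1 → uIcc x y ⊆ uIcc 0 1 := by
    intro x y hx hy
    rw [uIcc_of_le zero_le_one]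
    exact uIcc_subset_Icc hx hy
  have h01 : (0:ℝ) ∈ Icc (0:ℝ) 1 := by simp
  have hac : AbsolutelyContinuousOnInterval
      (fun ξ => F (γ ξ) - ∫ s in (0:ℝ)..ξ, F' (γ s) (v s)) 0 1 := by
    have hg := hv.norm.absolutelyContinuousOnInterval_intervalIntegral (c := 0) (by simp)
    refine hg.of_dist_le (C := 2 * C) fun x hx y hy => ?_
    rw [uIcc_of_le zero_le_one] at hx hy
    have e0 : dist (∫ s in (0:ℝ)..x, ‖v s‖) (∫ s in (0:ℝ)..y, ‖v s‖) = |∫ s in y..x, ‖v s‖| := by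
      rw [Real.dist_eq, intervalIntegral.integral_interval_sub_left
        (hv.norm.mono_set (hsub h01 hx)) (hv.norm.mono_set (hsub h01 hy))]
    have e1 : ‖F (γ x) - F (γ y)‖ ≤ C * |∫ s in y..x, ‖v s‖| := by
      have h1 := (convex_closedBall (0:E) R).norm_image_sub_le_of_norm_hasFDerivWithin_le
        (f := F) (f' := F') (C := C) (fun z _ => (hF z).hasFDerivWithinAt) hC
        (x := γ y) (y := γ x) (by simpa using hR y hy) (by simpa using hR x hx)
      refine h1.trans ?_
      gcongr
      have : γ x - γ y = ∫ s in y..x, v s := by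
        rw [hγ x hx, hγ y hy, ← intervalIntegral.integral_interval_sub_left
          (hv.mono_set (hsub h01 hx)) (hv.mono_set (hsub h01 hy))]
        abel
      rw [this]
      exact intervalIntegral.norm_integral_le_abs_integral_norm
    have e2 : ‖∫ s in y..x, F' (γ s) (v s)‖ ≤ C * |∫ s in y..x, ‖v s‖| := by
      have : |∫ s in y..x, C * ‖v s‖| = C * |∫ s in y..x, ‖v s‖| := by
        rw [intervalIntegral.integral_const_mul, abs_mul, abs_of_nonneg hC0]
      rw [← this]
      refine intervalIntegral.norm_integral_le_abs_of_norm_le ?_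
        ((hv.norm.mono_set (hsub hy hx)).const_mul C)
      refine (ae_restrict_mem measurableSet_uIoc).mono fun s hs => ?_
      have hs' : s ∈ Icc (0:ℝ) 1 := uIcc_subset_Icc hy hx (uIoc_subset_uIcc hs)
      exact ((F' (γ s)).le_opNorm _).trans (by gcongr; exact hC _ (by simpa using hR s hs'))
    rw [e0, dist_eq_norm]
    calc _ = ‖(F (γ x) - F (γ y)) - ∫ s in y..x, F' (γ s) (v s)‖ := by
            rw [← intervalIntegral.integral_interval_sub_left (hw.mono_set (hsub h01 hx))
              (hw.mono_set (hsub h01 hy))]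
            congr 1; abel
      _ ≤ _ := (norm_sub_le _ _).trans (by linarith)
  have hder : ∀ᵐ x, x ∈ uIcc (0:ℝ) 1 →
      HasDerivAt (fun ξ => F (γ ξ) - ∫ s in (0:ℝ)..ξ, F' (γ s) (v s)) 0 x := by
    have h₁ : ∀ᵐ x : ℝ, x ≠ 0 := by simp [ae_iff, measure_singleton]
    have h₂ : ∀ᵐ x : ℝ, x ≠ 1 := by simp [ae_iff, measure_singleton]
    filter_upwards [hv.ae_hasDerivAt_integral, hw.ae_hasDerivAt_integral, h₁, h₂]
      with x hx hx' hx0 hx1 hmem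
    have hv' := hx hmem 0 (by simp)
    have hw' := hx' hmem 0 (by simp)
    rw [uIcc_of_le zero_le_one] at hmem
    have hn : Icc (0:ℝ) 1 ∈ nhds x :=
      Icc_mem_nhds (lt_of_le_of_ne hmem.1 (Ne.symm hx0)) (lt_of_le_of_ne hmem.2 hx1)
    have hγ' : HasDerivAt γ (v x) x := by
      refine (hv'.const_add (γ 0)).congr_of_eventuallyEq ?_
      filter_upwards [hn] with y hy using hγ y hy
    have h := ((hF (γ x)).comp_hasDerivAt x hγ').sub hw'
    rw [sub_self] at h
    exact h
  obtain ⟨c, hc⟩ := hac.const_of_ae_hasDerivAt_zero hder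
  rw [uIcc_of_le zero_le_one] at hc
  have h0 := hc 0 h01
  have h1 := hc ξ hξ
  simp only [intervalIntegral.integral_same, sub_zero] at h0
  rw [h0, ← h1]
  abel

/-- `φ` is the cosine transform of the finite measure `μ`, which has a finite fourth moment. -/
structure IsCosineTransform (φ : E3 → ℝ) (μ : Measure E3) : Prop where
  finite : IsFiniteMeasure μ
  moment : Integrable (fun k => ‖k‖ ^ 4) μ
  eq_integral : ∀ x, φ x = ∫ k, Real.cos (inner ℝ k x) ∂μ

lemma HypA.aestronglyMeasurable {φ φhat : E3 → ℝ} (hA : HypA φ φhat) :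
    AEStronglyMeasurable φhat := by
  have h : φhat = fun k => ((1 + ‖k‖ ^ 2) ^ 2)⁻¹ * ((1 + ‖k‖ ^ 2) ^ 2 * φhat k) := by
    ext k
    have : (1 + ‖k‖ ^ 2) ^ 2 ≠ 0 := by positivity
    field_simp
  rw [h]
  refine AEStronglyMeasurable.mul ?_ hA.moment.1
  have : Continuous fun k : E3 => ((1 + ‖k‖ ^ 2) ^ 2)⁻¹ :=
    Continuous.inv₀ (by fun_prop) (fun k => by positivity)
  exact this.aestronglyMeasurable

lemma HypA.integrable_mul {φ φhat : E3 → ℝ} (hA : HypA φ φhat) {p : E3 → ℝ} (hp : Continuous p)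
    (hle : ∀ k, ‖p k‖ ≤ (1 + ‖k‖ ^ 2) ^ 2) : Integrable (fun k => φhat k * p k) := by
  refine hA.moment.mono' (hA.aestronglyMeasurable.mul hp.aestronglyMeasurable)
    (Filter.Eventually.of_forall fun k => ?_)
  rw [norm_mul, Real.norm_of_nonneg (hA.nonneg k), mul_comm]
  exact mul_le_mul_of_nonneg_right (hle k) (hA.nonneg k)

lemma one_le_moment_weight (k : E3) : 1 ≤ (1 + ‖k‖ ^ 2) ^ 2 := by
  nlinarith [sq_nonneg ‖k‖, sq_nonneg (‖k‖ ^ 2)]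

/-- Fourier inversion for a function satisfying Hypothesis A. -/
lemma HypA.exists_eq_integral_cos {φ φhat : E3 → ℝ} (hA : HypA φ φhat) :
    ∃ c : ℝ, 0 ≤ c ∧ ∀ x, φ x = c * ∫ k, φhat k * Real.cos (inner ℝ k x) := by
  set f : E3 → ℂ := fun x => (φ x : ℂ) with hf
  have hfour : ∀ w, 𝓕 f w = (φhat ((-(2 * π)) • w) : ℂ) := by
    intro w
    rw [Real.fourier_eq', hA.fourier_eq, fourierInt]
    refine integral_congr_ae (Filter.Eventually.of_forall fun x => ?_)
    simp only [hf, smul_eq_mul]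
    congr 2
    rw [inner_smul_left, real_inner_comm]
    simp
    ring
  have hint : Integrable φhat := by
    simpa using hA.integrable_mul (p := fun _ => 1) continuous_const
      (fun k => by simpa using one_le_moment_weight k)
  have hR : (-(2 * π)) ≠ 0 := by simp [pi_ne_zero]
  have hint' : Integrable (𝓕 f) := by
    have : 𝓕 f = fun w => (φhat ((-(2 * π)) • w) : ℂ) := funext hfour
    rw [this]
    exact (hint.comp_smul hR).ofReal
  have hinv := Continuous.fourierInv_fourier_eq (f := f)
    (Complex.continuous_ofReal.comp hA.cont) hA.integrable.ofReal hint'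
  refine ⟨|((-(2 * π)) ^ Module.finrank ℝ E3)⁻¹|, abs_nonneg _, fun x => ?_⟩
  have h1 : (φ x : ℂ) = 𝓕⁻ (𝓕 f) x := by rw [hinv]
  rw [Real.fourierInv_eq'] at h1
  have h2 : ∀ w : E3, Complex.exp (↑(2 * π * inner ℝ w x) * Complex.I) • 𝓕 f w =
      (fun k : E3 => Complex.exp (-(inner ℝ k x : ℝ) * Complex.I) * (φhat k : ℂ))
        ((-(2 * π)) • w) := by
    intro w
    simp only [hfour, smul_eq_mul, inner_smul_left]
    congr 2
    simp
  simp_rw [h2] at h1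
  rw [Measure.integral_comp_smul volume
    (fun k : E3 => Complex.exp (-(inner ℝ k x : ℝ) * Complex.I) * (φhat k : ℂ))] at h1
  have h3 : φ x = (|((-(2 * π)) ^ Module.finrank ℝ E3)⁻¹| • ∫ k : E3,
      Complex.exp (-(inner ℝ k x : ℝ) * Complex.I) * (φhat k : ℂ)).re := by
    rw [← h1, Complex.ofReal_re]
  rw [h3, Complex.smul_re, smul_eq_mul]
  congr 1
  have h4 : Integrable fun k : E3 =>
      Complex.exp (-(inner ℝ k x : ℝ) * Complex.I) * (φhat k : ℂ) := by
    refine hint.ofReal.bdd_mul (c := 1) ?_ (Filter.Eventually.of_forall fun k => ?_)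
    · exact Continuous.aestronglyMeasurable (by fun_prop)
    · rw [← Complex.ofReal_neg, Complex.norm_exp_ofReal_mul_I]
  have h5 := integral_re h4
  simp only [RCLike.re_to_complex] at h5
  rw [← h5]
  refine integral_congr_ae (Filter.Eventually.of_forall fun k => ?_)
  simp only [← Complex.ofReal_neg]
  rw [Complex.re_mul_ofReal, Complex.exp_ofReal_mul_I_re, Real.cos_neg, mul_comm]

lemma HypA.exists_isCosineTransform {φ φhat : E3 → ℝ} (hA : HypA φ φhat) :
    ∃ μ : Measure E3, IsCosineTransform φ μ := by
  obtain ⟨c, hc, hφ⟩ := hA.exists_eq_integral_cos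
  set ρ : E3 → NNReal := fun k => (c * φhat k).toNNReal with hρ
  have hρm : AEMeasurable ρ := (hA.aestronglyMeasurable.aemeasurable.const_mul c).real_toNNReal
  have hρe : ∀ k, (ρ k : ℝ) = c * φhat k := fun k =>
    Real.coe_toNNReal _ (mul_nonneg hc (hA.nonneg k))
  have hint : ∀ p : E3 → ℝ, Continuous p → (∀ k, ‖p k‖ ≤ (1 + ‖k‖ ^ 2) ^ 2) →
      Integrable p (volume.withDensity fun k => (ρ k : ENNReal)) := by
    intro p hp hle
    rw [integrable_withDensity_iff_integrable_coe_smul₀ hρm]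
    refine ((hA.integrable_mul hp hle).const_mul c).congr (Filter.Eventually.of_forall fun k => ?_)
    simp only [hρe, smul_eq_mul]
    ring
  refine ⟨volume.withDensity fun k => (ρ k : ENNReal), ?_, ?_, fun x => ?_⟩
  · have := hint (fun _ => 1) continuous_const (fun k => by simpa using one_le_moment_weight k)
    rwa [integrable_const_iff_isFiniteMeasure one_ne_zero] at this
  · refine hint _ (by fun_prop) fun k => ?_
    rw [Real.norm_of_nonneg (by positivity)]
    nlinarith [sq_nonneg ‖k‖, sq_nonneg (‖k‖ ^ 2)]
  · rw [integral_withDensity_eq_integral_smul₀ hρm, hφ, ← integral_const_mul]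
    refine integral_congr_ae (Filter.Eventually.of_forall fun k => ?_)
    simp only [NNReal.smul_def, hρe, smul_eq_mul]
    ring

namespace IsCosineTransform

variable {φ : E3 → ℝ} {μ : Measure E3}

lemma integrable_of_le (h : IsCosineTransform φ μ) {F : Type*} [NormedAddCommGroup F]
    [SecondCountableTopology F]
    {p : E3 → F} (hp : Continuous p) (hle : ∀ k, ‖p k‖ ≤ 1 + ‖k‖ ^ 4) : Integrable p μ := by
  have := h.finite
  exact Integrable.mono' ((integrable_const 1).add h.moment) hp.aestronglyMeasurable
    (Filter.Eventually.of_forall hle)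

lemma integrable_norm_pow (h : IsCosineTransform φ μ) {n : ℕ} (hn : n ≤ 4) :
    Integrable (fun k => ‖k‖ ^ n) μ := by
  refine h.integrable_of_le (by fun_prop) fun k => ?_
  rw [norm_pow, norm_norm]
  rcases le_total ‖k‖ 1 with h1 | h1
  · linarith [pow_le_one₀ (n := n) (norm_nonneg k) h1, pow_nonneg (norm_nonneg k) 4]
  · linarith [pow_le_pow_right₀ h1 hn]

/-- The gradient of the cosine transform of `μ`, written as an integral. -/
def grad (μ : Measure E3) (x : E3) : E3 := ∫ k, -Real.sin (inner ℝ k x) • k ∂μ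

/-- The Hessian of the cosine transform of `μ`, written as an integral. -/
def hess (μ : Measure E3) (x : E3) : E3 →L[ℝ] E3 :=
  ∫ k, -Real.cos (inner ℝ k x) • (innerSL ℝ k).smulRight k ∂μ

lemma integrable_grad (h : IsCosineTransform φ μ) (x : E3) :
    Integrable (fun k => -Real.sin (inner ℝ k x) • k) μ := by
  refine (h.integrable_norm_pow (n := 1) (by norm_num)).mono'
    (Continuous.aestronglyMeasurable (by fun_prop)) (Filter.Eventually.of_forall fun k => ?_)
  rw [norm_smul, norm_neg, pow_one]
  exact mul_le_of_le_one_left (norm_nonneg _) (Real.abs_sin_le_one _)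

lemma norm_smulRight_self (k : E3) : ‖(innerSL ℝ k).smulRight k‖ = ‖k‖ ^ 2 := by
  rw [ContinuousLinearMap.norm_smulRight_apply, innerSL_apply_norm, sq]

lemma integrable_hess (h : IsCosineTransform φ μ) (x : E3) :
    Integrable (fun k => -Real.cos (inner ℝ k x) • (innerSL ℝ k).smulRight k) μ := by
  refine (h.integrable_norm_pow (n := 2) (by norm_num)).mono'
    (Continuous.aestronglyMeasurable (by fun_prop)) (Filter.Eventually.of_forall fun k => ?_)
  rw [norm_smul, norm_neg, norm_smulRight_self]
  exact mul_le_of_le_one_left (by positivity) (Real.abs_cos_le_one _)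

lemma hasFDerivAt (h : IsCosineTransform φ μ) (x : E3) :
    HasFDerivAt φ (innerSL ℝ (grad μ x)) x := by
  have := h.finite
  have hφ : φ = fun x => ∫ k, Real.cos (inner ℝ k x) ∂μ := funext h.eq_integral
  have e : innerSL ℝ (grad μ x) = ∫ k, innerSL ℝ (-Real.sin (inner ℝ k x) • k) ∂μ := by
    rw [grad, ContinuousLinearMap.integral_comp_comm _ (h.integrable_grad x)]
  rw [e, hφ]
  refine hasFDerivAt_integral_of_dominated_of_fderiv_le (s := univ) (bound := fun k => ‖k‖ ^ 1)
    (F' := fun x k => innerSL ℝ (-Real.sin (inner ℝ k x) • k)) Filter.univ_mem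
    (Filter.Eventually.of_forall fun y => Continuous.aestronglyMeasurable (by fun_prop))
    (h.integrable_of_le (by fun_prop) fun k => ?_)
    (Continuous.aestronglyMeasurable (by fun_prop))
    (Filter.Eventually.of_forall fun k y _ => ?_) (h.integrable_norm_pow (by norm_num))
    (Filter.Eventually.of_forall fun k y _ => ?_)
  · linarith [Real.norm_eq_abs (Real.cos (inner ℝ k x)), Real.abs_cos_le_one (inner ℝ k x),
      pow_nonneg (norm_nonneg k) 4]
  · rw [innerSL_apply_norm, norm_smul, norm_neg, pow_one]
    exact mul_le_of_le_one_left (norm_nonneg _) (Real.abs_sin_le_one _)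
  · have := ((innerSL ℝ k).hasFDerivAt (x := y)).cos
    exact this.congr_fderiv (map_smul (innerSL ℝ) _ k).symm

lemma gradient_eq (h : IsCosineTransform φ μ) (x : E3) : gradient φ x = grad μ x :=
  HasGradientAt.gradient (h.hasFDerivAt x)

lemma hasFDerivAt_grad (h : IsCosineTransform φ μ) (x : E3) :
    HasFDerivAt (grad μ) (hess μ x) x := by
  refine hasFDerivAt_integral_of_dominated_of_fderiv_le (s := univ) (bound := fun k => ‖k‖ ^ 2)
    (F' := fun x k => -Real.cos (inner ℝ k x) • (innerSL ℝ k).smulRight k) Filter.univ_mem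
    (Filter.Eventually.of_forall fun y => Continuous.aestronglyMeasurable (by fun_prop))
    (h.integrable_grad x)
    (Continuous.aestronglyMeasurable (by fun_prop))
    (Filter.Eventually.of_forall fun k y _ => ?_) (h.integrable_norm_pow (by norm_num))
    (Filter.Eventually.of_forall fun k y _ => ?_)
  · rw [norm_smul, norm_neg, norm_smulRight_self]
    exact mul_le_of_le_one_left (by positivity) (Real.abs_cos_le_one _)
  · have := (((innerSL ℝ k).hasFDerivAt (x := y)).sin.neg).smul_const k
    refine this.congr_fderiv (ContinuousLinearMap.ext fun v : E3 => ?_)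
    simp [mul_smul]

lemma abs_cos_sub_cos_le (a b : ℝ) : |Real.cos a - Real.cos b| ≤ |a - b| := by
  simpa [Real.dist_eq] using Real.lipschitzWith_cos.dist_le_mul a b

lemma abs_sin_sub_sin_le (a b : ℝ) : |Real.sin a - Real.sin b| ≤ |a - b| := by
  simpa [Real.dist_eq] using Real.lipschitzWith_sin.dist_le_mul a b

lemma norm_grad_le (h : IsCosineTransform φ μ) (x : E3) : ‖grad μ x‖ ≤ ∫ k, ‖k‖ ∂μ := by
  refine norm_integral_le_of_norm_le (by simpa using h.integrable_norm_pow (n := 1) (by norm_num))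
    (Filter.Eventually.of_forall fun k => ?_)
  rw [norm_smul, norm_neg]
  exact mul_le_of_le_one_left (norm_nonneg _) (Real.abs_sin_le_one _)

lemma norm_hess_le (h : IsCosineTransform φ μ) (x : E3) : ‖hess μ x‖ ≤ ∫ k, ‖k‖ ^ 2 ∂μ := by
  refine norm_integral_le_of_norm_le (h.integrable_norm_pow (n := 2) (by norm_num))
    (Filter.Eventually.of_forall fun k => ?_)
  rw [norm_smul, norm_neg, norm_smulRight_self]
  exact mul_le_of_le_one_left (by positivity) (Real.abs_cos_le_one _)

lemma norm_hess_sub_le (h : IsCosineTransform φ μ) (x y : E3) :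
    ‖hess μ x - hess μ y‖ ≤ (∫ k, ‖k‖ ^ 3 ∂μ) * ‖x - y‖ := by
  rw [hess, hess, ← integral_sub (h.integrable_hess x) (h.integrable_hess y),
    ← integral_mul_const]
  refine norm_integral_le_of_norm_le ((h.integrable_norm_pow (n := 3) (by norm_num)).mul_const _)
    (Filter.Eventually.of_forall fun k => ?_)
  rw [← sub_smul, norm_smul, norm_smulRight_self, neg_sub_neg, Real.norm_eq_abs]
  have h1 : |Real.cos (inner ℝ k y) - Real.cos (inner ℝ k x)| ≤ ‖k‖ * ‖x - y‖ := by
    refine (abs_cos_sub_cos_le _ _).trans ?_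
    rw [← inner_sub_right, norm_sub_rev]
    exact abs_real_inner_le_norm _ _
  nlinarith [mul_le_mul_of_nonneg_right h1 (sq_nonneg ‖k‖)]

end IsCosineTransform

/-- `K` is a bounded operator-valued kernel with bounded and Lipschitz derivative `K'`. -/
structure IsSmoothKernel (K : E3 → E3 →L[ℝ] E3) (K' : E3 → E3 →L[ℝ] E3 →L[ℝ] E3) (B : ℝ) :
    Prop where
  norm_le : ∀ x, ‖K x‖ ≤ B
  hasFDerivAt : ∀ x, HasFDerivAt K (K' x) x
  norm_deriv_le : ∀ x, ‖K' x‖ ≤ B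
  norm_deriv_sub_le : ∀ x y, ‖K' x - K' y‖ ≤ B * ‖x - y‖

lemma norm_crossL_comp_le (L : E3 →L[ℝ] E3) : ‖crossL.comp L‖ ≤ ‖L‖ :=
  ContinuousLinearMap.opNorm_le_bound _ (norm_nonneg _) fun x =>
    (norm_crossL_le _).trans (L.le_opNorm x)

lemma IsCosineTransform.exists_isSmoothKernel {φ : E3 → ℝ} {μ : Measure E3}
    (h : IsCosineTransform φ μ) :
    ∃ B K', IsSmoothKernel (fun x => crossL (gradient φ x)) K' B := by
  have h1 : 0 ≤ ∫ k, ‖k‖ ∂μ := integral_nonneg fun k => norm_nonneg k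
  have h2 : 0 ≤ ∫ k, ‖k‖ ^ 2 ∂μ := integral_nonneg fun k => by positivity
  have h3 : 0 ≤ ∫ k, ‖k‖ ^ 3 ∂μ := integral_nonneg fun k => by positivity
  refine ⟨(∫ k, ‖k‖ ∂μ) + (∫ k, ‖k‖ ^ 2 ∂μ) + ∫ k, ‖k‖ ^ 3 ∂μ,
    fun x => crossL.comp (hess μ x), ?_⟩
  simp_rw [h.gradient_eq]
  refine ⟨fun x => ?_, fun x => ?_, fun x => ?_, fun x y => ?_⟩
  · linarith [norm_crossL_le (grad μ x), h.norm_grad_le x]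
  · exact crossL.hasFDerivAt.comp x (h.hasFDerivAt_grad x)
  · linarith [norm_crossL_comp_le (hess μ x), h.norm_hess_le x]
  · rw [← ContinuousLinearMap.comp_sub]
    refine (norm_crossL_comp_le _).trans ((h.norm_hess_sub_le x y).trans ?_)
    gcongr
    linarith

lemma IsH1Loop.intervalIntegrable {γ v : ℝ → E3} (h : IsH1Loop γ v) :
    IntervalIntegrable v volume 0 1 := by
  rw [intervalIntegrable_iff_integrableOn_Ioc_of_le zero_le_one]
  exact h.memL2.integrable (by norm_num)

lemma IsH1Loop.continuousOn {γ v : ℝ → E3} (h : IsH1Loop γ v) : ContinuousOn γ (Icc 0 1) :=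
  continuousOn_of_eq_add_integral h.intervalIntegrable h.deriv_eq

lemma IsH1Loop.sub_eq_add_integral {γ₁ v₁ γ₂ v₂ : ℝ → E3} (h₁ : IsH1Loop γ₁ v₁)
    (h₂ : IsH1Loop γ₂ v₂) {ξ : ℝ} (hξ : ξ ∈ Icc (0:ℝ) 1) :
    γ₁ ξ - γ₂ ξ = γ₁ 0 - γ₂ 0 + ∫ s in (0:ℝ)..ξ, (v₁ s - v₂ s) := by
  have hsub : uIcc 0 ξ ⊆ uIcc (0:ℝ) 1 := by
    rw [uIcc_of_le hξ.1, uIcc_of_le zero_le_one]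
    exact Icc_subset_Icc_right hξ.2
  rw [intervalIntegral.integral_sub (h₁.intervalIntegrable.mono_set hsub)
    (h₂.intervalIntegrable.mono_set hsub), h₁.deriv_eq ξ hξ, h₂.deriv_eq ξ hξ]
  abel

lemma IsH1Loop.integrable_norm_sq {γ v : ℝ → E3} (h : IsH1Loop γ v) :
    Integrable (fun s => ‖v s‖ ^ 2) (volume.restrict (Ioc 0 1)) :=
  h.memL2.integrable_norm_pow (by norm_num)

lemma IsH1Loop.integral_norm_le {γ v : ℝ → E3} (h : IsH1Loop γ v) {M : ℝ}
    (hM : ∫ ξ in Ioc (0:ℝ) 1, ‖v ξ‖ ^ 2 ≤ M) : ∫ ξ in (0:ℝ)..1, ‖v ξ‖ ≤ 1 + M := by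
  rw [intervalIntegral.integral_of_le zero_le_one]
  have hone : Integrable (fun _ => (1:ℝ)) (volume.restrict (Ioc (0:ℝ) 1)) := integrable_const _
  calc ∫ ξ in Ioc (0:ℝ) 1, ‖v ξ‖ ≤ ∫ ξ in Ioc (0:ℝ) 1, (1 + ‖v ξ‖ ^ 2) := by
        refine integral_mono (h.memL2.integrable (by norm_num)).norm
          (hone.add h.integrable_norm_sq) fun ξ => ?_
        simp only
        nlinarith [sq_nonneg (‖v ξ‖ - 1), sq_nonneg ‖v ξ‖]
    _ = 1 + ∫ ξ in Ioc (0:ℝ) 1, ‖v ξ‖ ^ 2 := by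
        rw [integral_add hone h.integrable_norm_sq]
        simp
    _ ≤ 1 + M := by gcongr

namespace IsSmoothKernel

variable {K : E3 → E3 →L[ℝ] E3} {K' : E3 → E3 →L[ℝ] E3 →L[ℝ] E3} {B : ℝ}

lemma nonneg (hK : IsSmoothKernel K K' B) : 0 ≤ B := (norm_nonneg _).trans (hK.norm_le 0)

lemma continuous (hK : IsSmoothKernel K K' B) : Continuous K :=
  continuous_iff_continuousAt.2 fun x => (hK.hasFDerivAt x).continuousAt

lemma continuous_deriv (hK : IsSmoothKernel K K' B) : Continuous K' := by
  have h : LipschitzWith ⟨B, hK.nonneg⟩ K' := LipschitzWith.of_dist_le_mul fun x y => by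
    rw [dist_eq_norm, dist_eq_norm]
    exact hK.norm_deriv_sub_le x y
  exact h.continuous

lemma contDiff (hK : IsSmoothKernel K K' B) : ContDiff ℝ 1 K := by
  rw [contDiff_one_iff_hasFDerivAt]
  exact ⟨K', hK.continuous_deriv, hK.hasFDerivAt⟩

lemma norm_sub_le (hK : IsSmoothKernel K K' B) (x y : E3) : ‖K x - K y‖ ≤ B * ‖x - y‖ :=
  convex_univ.norm_image_sub_le_of_norm_hasFDerivWithin_le
    (fun z _ => (hK.hasFDerivAt z).hasFDerivWithinAt) (fun z _ => hK.norm_deriv_le z)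
    (mem_univ y) (mem_univ x)

/-- Integration by parts on closed curves. -/
lemma integral_apply_sub (hK : IsSmoothKernel K K' B) {σ₁ d₁ σ₂ d₂ : ℝ → E3}
    (h₁ : IsH1Loop σ₁ d₁) (h₂ : IsH1Loop σ₂ d₂) (x : E3) :
    ∫ η in (0:ℝ)..1, K (x - σ₂ η) (d₁ η - d₂ η) =
      ∫ η in (0:ℝ)..1, K' (x - σ₂ η) (d₂ η) (σ₁ η - σ₂ η) := by
  have hF : ContDiff ℝ 1 fun q : E3 × E3 => K (x - q.1) q.2 :=
    (hK.contDiff.comp (by fun_prop)).clm_apply contDiff_snd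
  have hd : ∀ q : E3 × E3, ∀ r : E3 × E3, fderiv ℝ (fun q : E3 × E3 => K (x - q.1) q.2) q r =
      K (x - q.1) r.2 - K' (x - q.1) r.1 q.2 := by
    intro q r
    have h1 : HasFDerivAt (fun q : E3 × E3 => x - q.1) (-ContinuousLinearMap.fst ℝ E3 E3) q :=
      (hasFDerivAt_fst).const_sub x
    have h2 : HasFDerivAt (fun q : E3 × E3 => K (x - q.1) q.2) _ q :=
      ((hK.hasFDerivAt (x - q.1)).comp q h1).clm_apply hasFDerivAt_snd
    rw [h2.fderiv]
    simp
    abel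
  have hcσ := h₂.continuousOn
  have hcσ₁ := h₁.continuousOn
  have hi1 : IntervalIntegrable (fun η => K (x - σ₂ η) (d₁ η - d₂ η)) volume 0 1 :=
    (hK.continuous.comp_continuousOn (continuousOn_const.sub hcσ)).intervalIntegrable_clm_apply
      (h₁.intervalIntegrable.sub h₂.intervalIntegrable)
  have hi2 : IntervalIntegrable (fun η => K' (x - σ₂ η) (d₂ η) (σ₁ η - σ₂ η)) volume 0 1 := by
    have hc : ContinuousOn (fun η => (K' (x - σ₂ η)).flip (σ₁ η - σ₂ η)) (Icc 0 1) := by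
      have h3 : ContinuousOn (fun η => (K' (x - σ₂ η)).flip) (Icc 0 1) :=
        (ContinuousLinearMap.flipₗᵢ ℝ E3 E3 E3).continuous.comp_continuousOn
          (hK.continuous_deriv.comp_continuousOn (continuousOn_const.sub hcσ))
      exact h3.clm_apply (hcσ₁.sub hcσ)
    exact hc.intervalIntegrable_clm_apply h₂.intervalIntegrable
  have hv : IntervalIntegrable (fun s => (d₂ s, d₁ s - d₂ s)) volume 0 1 :=
    ⟨h₂.intervalIntegrable.1.prodMk (h₁.intervalIntegrable.sub h₂.intervalIntegrable).1,
      h₂.intervalIntegrable.2.prodMk (h₁.intervalIntegrable.sub h₂.intervalIntegrable).2⟩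
  have key := comp_eq_add_integral_of_eq_add_integral
    (fun q => (hF.differentiable (by norm_num) q).hasFDerivAt) (hF.continuous_fderiv (by norm_num))
    (γ := fun s => (σ₂ s, σ₁ s - σ₂ s)) hv (fun ξ hξ => ?_) (ξ := 1) (by simp)
  · simp only [hd, h₁.closed, h₂.closed] at key
    have h0 := left_eq_add.1 key
    rw [intervalIntegral.integral_sub hi1 hi2, sub_eq_zero] at h0
    exact h0
  · have hsub : uIcc 0 ξ ⊆ uIcc (0:ℝ) 1 := by
      rw [uIcc_of_le hξ.1, uIcc_of_le zero_le_one]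
      exact Icc_subset_Icc_right hξ.2
    have e : ∫ s in (0:ℝ)..ξ, (d₂ s, d₁ s - d₂ s) =
        (∫ s in (0:ℝ)..ξ, d₂ s, ∫ s in (0:ℝ)..ξ, (d₁ s - d₂ s)) := by
      rw [intervalIntegral.integral_of_le hξ.1, intervalIntegral.integral_of_le hξ.1,
        intervalIntegral.integral_of_le hξ.1]
      exact integral_pair (h₂.intervalIntegrable.mono_set hsub).1
        ((h₁.intervalIntegrable.sub h₂.intervalIntegrable).mono_set hsub).1
    rw [e, h₁.sub_eq_add_integral h₂ hξ, h₂.deriv_eq ξ hξ]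
    rfl

/-- The induced velocity is stable with respect to uniform perturbations of the curve. -/
lemma norm_integral_sub_le (hK : IsSmoothKernel K K' B) {σ₁ d₁ σ₂ d₂ : ℝ → E3}
    (h₁ : IsH1Loop σ₁ d₁) (h₂ : IsH1Loop σ₂ d₂) {m D : ℝ}
    (hm₁ : ∫ η in (0:ℝ)..1, ‖d₁ η‖ ≤ m) (hm₂ : ∫ η in (0:ℝ)..1, ‖d₂ η‖ ≤ m)
    (hD : ∀ η ∈ Icc (0:ℝ) 1, ‖σ₁ η - σ₂ η‖ ≤ D) (x₁ x₂ : E3) :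
    ‖(∫ η in (0:ℝ)..1, K (x₁ - σ₁ η) (d₁ η)) - ∫ η in (0:ℝ)..1, K (x₂ - σ₂ η) (d₂ η)‖ ≤
      B * m * (‖x₁ - x₂‖ + 2 * D) := by
  have hB := hK.nonneg
  have hD0 : 0 ≤ D := (norm_nonneg _).trans (hD 0 (by simp))
  have hi : ∀ {σ d : ℝ → E3} (x : E3), ContinuousOn σ (Icc 0 1) →
      IntervalIntegrable d volume 0 1 →
      IntervalIntegrable (fun η => K (x - σ η) (d η)) volume 0 1 := fun x hσ hd =>
    (hK.continuous.comp_continuousOn (continuousOn_const.sub hσ)).intervalIntegrable_clm_apply hd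
  have i₁ := hi x₁ h₁.continuousOn h₁.intervalIntegrable
  have i₂ := hi x₂ h₂.continuousOn h₂.intervalIntegrable
  have i₃ := hi x₂ h₂.continuousOn h₁.intervalIntegrable
  have i₄ := hi x₂ h₂.continuousOn (h₁.intervalIntegrable.sub h₂.intervalIntegrable)
  have split : (∫ η in (0:ℝ)..1, K (x₁ - σ₁ η) (d₁ η)) - ∫ η in (0:ℝ)..1, K (x₂ - σ₂ η) (d₂ η) =
      (∫ η in (0:ℝ)..1, (K (x₁ - σ₁ η) - K (x₂ - σ₂ η)) (d₁ η)) +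
        ∫ η in (0:ℝ)..1, K' (x₂ - σ₂ η) (d₂ η) (σ₁ η - σ₂ η) := by
    rw [← hK.integral_apply_sub h₁ h₂]
    simp only [sub_apply, map_sub]
    rw [intervalIntegral.integral_sub i₁ i₃, intervalIntegral.integral_sub i₃ i₂]
    abel
  have b₁ : ‖∫ η in (0:ℝ)..1, (K (x₁ - σ₁ η) - K (x₂ - σ₂ η)) (d₁ η)‖ ≤
      ∫ η in (0:ℝ)..1, B * (‖x₁ - x₂‖ + D) * ‖d₁ η‖ := by
    refine intervalIntegral.norm_integral_le_of_norm_le zero_le_one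
      (Filter.Eventually.of_forall fun η hη => ?_) (h₁.intervalIntegrable.norm.const_mul _)
    refine (ContinuousLinearMap.le_opNorm _ _).trans ?_
    gcongr
    refine (hK.norm_sub_le _ _).trans ?_
    gcongr
    calc ‖x₁ - σ₁ η - (x₂ - σ₂ η)‖ = ‖(x₁ - x₂) - (σ₁ η - σ₂ η)‖ := by congr 1; abel
      _ ≤ _ := (_root_.norm_sub_le _ _).trans (by gcongr; exact hD η (Ioc_subset_Icc_self hη))
  have b₂ : ‖∫ η in (0:ℝ)..1, K' (x₂ - σ₂ η) (d₂ η) (σ₁ η - σ₂ η)‖ ≤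
      ∫ η in (0:ℝ)..1, B * D * ‖d₂ η‖ := by
    refine intervalIntegral.norm_integral_le_of_norm_le zero_le_one
      (Filter.Eventually.of_forall fun η hη => ?_) (h₂.intervalIntegrable.norm.const_mul _)
    calc ‖K' (x₂ - σ₂ η) (d₂ η) (σ₁ η - σ₂ η)‖ ≤ ‖K' (x₂ - σ₂ η)‖ * ‖d₂ η‖ * ‖σ₁ η - σ₂ η‖ :=
          ContinuousLinearMap.le_opNorm₂ _ _ _
      _ ≤ B * ‖d₂ η‖ * D := by
          gcongr
          · exact hK.norm_deriv_le _
          · exact hD η (Ioc_subset_Icc_self hη)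
      _ = B * D * ‖d₂ η‖ := by ring
  rw [intervalIntegral.integral_const_mul] at b₁ b₂
  have c₁ := mul_le_mul_of_nonneg_left hm₁ (by positivity : 0 ≤ B * (‖x₁ - x₂‖ + D))
  have c₂ := mul_le_mul_of_nonneg_left hm₂ (by positivity : 0 ≤ B * D)
  rw [split]
  refine (norm_add_le _ _).trans ?_
  nlinarith

lemma norm_integral_le (hK : IsSmoothKernel K K' B) {σ d : ℝ → E3} {m : ℝ}
    (hd : IntervalIntegrable d volume 0 1) (hm : ∫ η in (0:ℝ)..1, ‖d η‖ ≤ m) (x : E3) :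
    ‖∫ η in (0:ℝ)..1, K (x - σ η) (d η)‖ ≤ B * m := by
  have b : ‖∫ η in (0:ℝ)..1, K (x - σ η) (d η)‖ ≤ ∫ η in (0:ℝ)..1, B * ‖d η‖ := by
    refine intervalIntegral.norm_integral_le_of_norm_le zero_le_one
      (Filter.Eventually.of_forall fun η hη => ?_) (hd.norm.const_mul _)
    exact (ContinuousLinearMap.le_opNorm _ _).trans (by gcongr; exact hK.norm_le _)
  rw [intervalIntegral.integral_const_mul] at b
  exact b.trans (mul_le_mul_of_nonneg_left hm hK.nonneg)

end IsSmoothKernel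

/-- An interpolation inequality bounding the supremum of an `H¹` function. -/
lemma norm_sq_le_of_eq_add_integral {f v : ℝ → E3} (hv : MemLp v 2 (volume.restrict (Ioc 0 1)))
    (hf : ∀ ξ ∈ Icc (0:ℝ) 1, f ξ = f 0 + ∫ s in (0:ℝ)..ξ, v s) {ε : ℝ} (hε : 0 < ε)
    {ξ : ℝ} (hξ : ξ ∈ Icc (0:ℝ) 1) :
    ‖f ξ‖ ^ 2 ≤ (1 + ε⁻¹) * (∫ η in Ioc (0:ℝ) 1, ‖f η‖ ^ 2) +
      ε * ∫ η in Ioc (0:ℝ) 1, ‖v η‖ ^ 2 := by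
  have hvi : IntervalIntegrable v volume 0 1 := by
    rw [intervalIntegrable_iff_integrableOn_Ioc_of_le zero_le_one]
    exact hv.integrable (by norm_num)
  have hfc := continuousOn_of_eq_add_integral hvi hf
  have hf2 : IntervalIntegrable (fun η => ‖f η‖ ^ 2) volume 0 1 :=
    ContinuousOn.intervalIntegrable (by rw [uIcc_of_le zero_le_one]; exact hfc.norm.pow 2)
  have hv2 : IntervalIntegrable (fun η => ‖v η‖ ^ 2) volume 0 1 := by
    rw [intervalIntegrable_iff_integrableOn_Ioc_of_le zero_le_one]
    exact hv.integrable_norm_pow (by norm_num)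
  have hbi := (hf2.const_mul ε⁻¹).add (hv2.const_mul ε)
  set J := ∫ η in (0:ℝ)..1, (ε⁻¹ * ‖f η‖ ^ 2 + ε * ‖v η‖ ^ 2) with hJ
  have hderiv : ∀ x : E3, HasFDerivAt (fun x : E3 => ‖x‖ ^ 2) ((2:ℝ) • innerSL ℝ x) x := by
    intro x
    refine (hasStrictFDerivAt_norm_sq x).hasFDerivAt.congr_fderiv ?_
    rw [two_smul, two_smul]
  have hcd : Continuous fun x : E3 => (2:ℝ) • innerSL ℝ x := by fun_prop
  have hwi : IntervalIntegrable (fun s => ((2:ℝ) • innerSL ℝ (f s)) (v s)) volume 0 1 :=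
    (hcd.comp_continuousOn hfc).intervalIntegrable_clm_apply hvi
  have hsub : ∀ {x y : ℝ}, x ∈ Icc (0:ℝ) 1 → y ∈ Icc (0:ℝ) 1 → uIcc x y ⊆ uIcc 0 1 := by
    intro x y hx hy
    rw [uIcc_of_le zero_le_one]
    exact uIcc_subset_Icc hx hy
  have h01 : (0:ℝ) ∈ Icc (0:ℝ) 1 := by simp
  have hpt : ∀ η ∈ Icc (0:ℝ) 1, ‖f ξ‖ ^ 2 ≤ ‖f η‖ ^ 2 + J := by
    intro η hη
    have h1 := comp_eq_add_integral_of_eq_add_integral hderiv hcd hvi hf hξ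
    have h2 := comp_eq_add_integral_of_eq_add_integral hderiv hcd hvi hf hη
    have h3 := intervalIntegral.integral_interval_sub_left (hwi.mono_set (hsub h01 hξ))
      (hwi.mono_set (hsub h01 hη))
    have h4 : |∫ s in η..ξ, ((2:ℝ) • innerSL ℝ (f s)) (v s)| ≤ J := by
      rw [← Real.norm_eq_abs]
      refine (intervalIntegral.norm_integral_le_abs_of_norm_le
        (g := fun η => ε⁻¹ * ‖f η‖ ^ 2 + ε * ‖v η‖ ^ 2) ?_
        (hbi.mono_set (hsub hη hξ))).trans ?_
      · refine Filter.Eventually.of_forall fun s => ?_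
        have h5 : |inner ℝ (f s) (v s)| ≤ ‖f s‖ * ‖v s‖ := abs_real_inner_le_norm _ _
        have h6 : 2 * (‖f s‖ * ‖v s‖) ≤ ε⁻¹ * ‖f s‖ ^ 2 + ε * ‖v s‖ ^ 2 := by
          have := mul_nonneg (inv_pos.2 hε).le (sq_nonneg (‖f s‖ - ε * ‖v s‖))
          have e : ε⁻¹ * (‖f s‖ - ε * ‖v s‖) ^ 2 =
              ε⁻¹ * ‖f s‖ ^ 2 + ε * ‖v s‖ ^ 2 - 2 * (‖f s‖ * ‖v s‖) := by
            field_simp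
            ring
          linarith
        simp only [smul_apply, innerSL_apply_apply, smul_eq_mul, norm_mul,
          Real.norm_eq_abs, abs_two]
        linarith
      · rw [intervalIntegral.abs_integral_eq_abs_integral_uIoc]
        rw [hJ, intervalIntegral.integral_of_le zero_le_one, abs_of_nonneg
          (integral_nonneg fun s => by positivity)]
        refine setIntegral_mono_set hbi.1 (Filter.Eventually.of_forall fun s => by
          simp only [Pi.zero_apply]; positivity) ?_
        refine (?_ : uIoc η ξ ⊆ Ioc 0 1).eventuallyLE
        exact Ioc_subset_Ioc (le_inf hη.1 hξ.1) (sup_le hη.2 hξ.2)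
    linarith [le_abs_self (∫ s in η..ξ, ((2:ℝ) • innerSL ℝ (f s)) (v s))]
  have hint : ∫ η in (0:ℝ)..1, ‖f ξ‖ ^ 2 ≤ ∫ η in (0:ℝ)..1, (‖f η‖ ^ 2 + J) :=
    intervalIntegral.integral_mono_on zero_le_one (by simp) (hf2.add (by simp)) hpt
  have hJ' : J = ε⁻¹ * (∫ η in (0:ℝ)..1, ‖f η‖ ^ 2) + ε * ∫ η in (0:ℝ)..1, ‖v η‖ ^ 2 := by
    rw [hJ, intervalIntegral.integral_add (hf2.const_mul ε⁻¹) (hv2.const_mul ε),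
      intervalIntegral.integral_const_mul, intervalIntegral.integral_const_mul]
  rw [intervalIntegral.integral_add hf2 (by simp), intervalIntegral.integral_const,
    intervalIntegral.integral_const, sub_zero, one_smul, one_smul, hJ'] at hint
  rw [← intervalIntegral.integral_of_le zero_le_one, ← intervalIntegral.integral_of_le zero_le_one]
  linarith

lemma ContinuousOn.le_of_ae_restrict_le {f : ℝ → ℝ} {c : ℝ} (hf : ContinuousOn f (Icc 0 1))
    (h : ∀ᵐ ξ ∂(volume.restrict (Ioc (0:ℝ) 1)), f ξ ≤ c) {ξ : ℝ} (hξ : ξ ∈ Icc (0:ℝ) 1) :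
    f ξ ≤ c := by
  have h' : (fun ξ => max (f ξ) c) =ᵐ[volume.restrict (Icc (0:ℝ) 1)] fun _ => c := by
    rw [← restrict_Ioc_eq_restrict_Icc]
    filter_upwards [h] with ξ h
    exact max_eq_right h
  exact max_eq_right_iff.1 (Measure.eqOn_Icc_of_ae_eq volume zero_ne_one h'
    (hf.sup continuousOn_const) continuousOn_const hξ)

/-- A family of closed curves, bounded in `H¹` and Lipschitz in `L²`, is Hölder continuous
in time, uniformly along the curve. -/
lemma exists_norm_sub_sq_le {σ d : ℝ → ℝ → E3} {T M L : ℝ}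
    (hσ : ∀ t ∈ Icc 0 T, IsH1Loop (σ t) (d t))
    (hM : ∀ t ∈ Icc 0 T, ∫ ξ in Ioc (0:ℝ) 1, ‖d t ξ‖ ^ 2 ≤ M)
    (hL : ∀ s ∈ Icc 0 T, ∀ t ∈ Icc 0 T,
      √(∫ ξ in Ioc (0:ℝ) 1, ‖σ t ξ - σ s ξ‖ ^ 2) ≤ L * |t - s|) :
    ∃ C : ℝ, ∀ s ∈ Icc 0 T, ∀ t ∈ Icc 0 T, ∀ ξ ∈ Icc (0:ℝ) 1,
      ‖σ t ξ - σ s ξ‖ ^ 2 ≤ C * |t - s| := by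
  refine ⟨L ^ 2 * (T + 1) + 4 * M, fun s hs t ht ξ hξ => ?_⟩
  rcases eq_or_ne t s with rfl | hne
  · simp
  have hδ : 0 < |t - s| := abs_pos.2 (sub_ne_zero.2 hne)
  have hδT : |t - s| ≤ T := abs_le.2 ⟨by linarith [ht.1, hs.2], by linarith [ht.2, hs.1]⟩
  have h1 := norm_sq_le_of_eq_add_integral (f := fun ξ => σ t ξ - σ s ξ)
    (v := fun ξ => d t ξ - d s ξ) ((hσ t ht).memL2.sub (hσ s hs).memL2)
    (fun ξ hξ => (hσ t ht).sub_eq_add_integral (hσ s hs) hξ) hδ hξ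
  have h2 := (Real.sqrt_le_iff.1 (hL s hs t ht)).2
  have h3 : ∫ ξ in Ioc (0:ℝ) 1, ‖d t ξ - d s ξ‖ ^ 2 ≤ 4 * M := by
    have it := (hσ t ht).integrable_norm_sq
    have is := (hσ s hs).integrable_norm_sq
    calc ∫ ξ in Ioc (0:ℝ) 1, ‖d t ξ - d s ξ‖ ^ 2
        ≤ ∫ ξ in Ioc (0:ℝ) 1, (2 * ‖d t ξ‖ ^ 2 + 2 * ‖d s ξ‖ ^ 2) := by
          refine integral_mono (((hσ t ht).memL2.sub (hσ s hs).memL2).integrable_norm_pow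
            (by norm_num)) ((it.const_mul 2).add (is.const_mul 2)) fun ξ => ?_
          have h := norm_sub_le (d t ξ) (d s ξ)
          have h' := pow_le_pow_left₀ (norm_nonneg _) h 2
          simp only
          nlinarith [sq_nonneg (‖d t ξ‖ - ‖d s ξ‖)]
      _ = 2 * (∫ ξ in Ioc (0:ℝ) 1, ‖d t ξ‖ ^ 2) + 2 * ∫ ξ in Ioc (0:ℝ) 1, ‖d s ξ‖ ^ 2 := by
          rw [integral_add (it.const_mul 2) (is.const_mul 2), integral_const_mul,
            integral_const_mul]
      _ ≤ 4 * M := by linarith [hM t ht, hM s hs]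
  calc ‖σ t ξ - σ s ξ‖ ^ 2 ≤ (1 + |t - s|⁻¹) * (L * |t - s|) ^ 2 + |t - s| * (4 * M) := by
        refine h1.trans ?_
        gcongr
    _ = (L ^ 2 * (|t - s| + 1) + 4 * M) * |t - s| := by
        field_simp
    _ ≤ (L ^ 2 * (T + 1) + 4 * M) * |t - s| := by gcongr

namespace IsSmoothKernel

variable {K : E3 → E3 →L[ℝ] E3} {K' : E3 → E3 →L[ℝ] E3 →L[ℝ] E3} {B : ℝ}

lemma continuousOn_integral (hK : IsSmoothKernel K K' B) {σ d : ℝ → ℝ → E3} {T m C : ℝ}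
    (hσ : ∀ t ∈ Icc 0 T, IsH1Loop (σ t) (d t))
    (hm : ∀ t ∈ Icc 0 T, ∫ ξ in (0:ℝ)..1, ‖d t ξ‖ ≤ m)
    (hC : ∀ s ∈ Icc 0 T, ∀ t ∈ Icc 0 T, ∀ ξ ∈ Icc (0:ℝ) 1, ‖σ t ξ - σ s ξ‖ ^ 2 ≤ C * |t - s|)
    {ξ : ℝ} (hξ : ξ ∈ Icc (0:ℝ) 1) :
    ContinuousOn (fun τ => ∫ η in (0:ℝ)..1, K (σ τ ξ - σ τ η) (d τ η)) (Icc 0 T) := by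
  intro s hs
  rw [ContinuousWithinAt, tendsto_iff_norm_sub_tendsto_zero]
  have hlim : Filter.Tendsto (fun t => B * m * (√(C * |t - s|) + 2 * √(C * |t - s|)))
      (nhdsWithin s (Icc 0 T)) (nhds 0) := by
    have : Continuous fun t => B * m * (√(C * |t - s|) + 2 * √(C * |t - s|)) := by fun_prop
    simpa using (this.tendsto s).mono_left nhdsWithin_le_nhds
  refine squeeze_zero' (Filter.Eventually.of_forall fun _ => norm_nonneg _) ?_ hlim
  filter_upwards [self_mem_nhdsWithin] with t ht
  have hsq : ∀ η ∈ Icc (0:ℝ) 1, ‖σ t η - σ s η‖ ≤ √(C * |t - s|) := fun η hη =>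
    Real.le_sqrt_of_sq_le (hC s hs t ht η hη)
  refine (hK.norm_integral_sub_le (hσ t ht) (hσ s hs) (hm t ht) (hm s hs) hsq _ _).trans ?_
  have : 0 ≤ m := (intervalIntegral.integral_nonneg zero_le_one fun _ _ => norm_nonneg _).trans
    (hm s hs)
  have := hK.nonneg
  gcongr
  exact hsq ξ hξ

/-- Uniqueness for the filament evolution among families of closed curves which are bounded in
`H¹` and Hölder continuous in time. -/
lemma eq_of_integral_eq (hK : IsSmoothKernel K K' B) {σ₀ : ℝ → E3} {σ₁ d₁ σ₂ d₂ : ℝ → ℝ → E3}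
    {T m C₁ C₂ : ℝ}
    (h₁ : ∀ t ∈ Icc 0 T, IsH1Loop (σ₁ t) (d₁ t)) (h₂ : ∀ t ∈ Icc 0 T, IsH1Loop (σ₂ t) (d₂ t))
    (hm₁ : ∀ t ∈ Icc 0 T, ∫ ξ in (0:ℝ)..1, ‖d₁ t ξ‖ ≤ m)
    (hm₂ : ∀ t ∈ Icc 0 T, ∫ ξ in (0:ℝ)..1, ‖d₂ t ξ‖ ≤ m)
    (hC₁ : ∀ s ∈ Icc 0 T, ∀ t ∈ Icc 0 T, ∀ ξ ∈ Icc (0:ℝ) 1,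
      ‖σ₁ t ξ - σ₁ s ξ‖ ^ 2 ≤ C₁ * |t - s|)
    (hC₂ : ∀ s ∈ Icc 0 T, ∀ t ∈ Icc 0 T, ∀ ξ ∈ Icc (0:ℝ) 1,
      ‖σ₂ t ξ - σ₂ s ξ‖ ^ 2 ≤ C₂ * |t - s|)
    (he₁ : ∀ t ∈ Icc 0 T, ∀ᵐ ξ ∂(volume.restrict (Ioc (0:ℝ) 1)),
      σ₁ t ξ = σ₀ ξ + ∫ τ in (0:ℝ)..t, ∫ η in (0:ℝ)..1, K (σ₁ τ ξ - σ₁ τ η) (d₁ τ η))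
    (he₂ : ∀ t ∈ Icc 0 T, ∀ᵐ ξ ∂(volume.restrict (Ioc (0:ℝ) 1)),
      σ₂ t ξ = σ₀ ξ + ∫ τ in (0:ℝ)..t, ∫ η in (0:ℝ)..1, K (σ₂ τ ξ - σ₂ τ η) (d₂ τ η))
    {t : ℝ} (ht : t ∈ Icc 0 T) {ξ : ℝ} (hξ : ξ ∈ Icc (0:ℝ) 1) : σ₁ t ξ = σ₂ t ξ := by
  have hB := hK.nonneg
  have hm : 0 ≤ m := (intervalIntegral.integral_nonneg zero_le_one fun _ _ => norm_nonneg _).trans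
    (hm₁ t ht)
  -- propagation of a bound on the velocity difference
  have step : ∀ b : ℝ → ℝ, Continuous b → (∀ τ ∈ Icc 0 T, ∀ ξ ∈ Icc (0:ℝ) 1,
      ‖(∫ η in (0:ℝ)..1, K (σ₁ τ ξ - σ₁ τ η) (d₁ τ η)) -
        ∫ η in (0:ℝ)..1, K (σ₂ τ ξ - σ₂ τ η) (d₂ τ η)‖ ≤ b τ) →
      ∀ t ∈ Icc 0 T, ∀ ξ ∈ Icc (0:ℝ) 1, ‖σ₁ t ξ - σ₂ t ξ‖ ≤ ∫ τ in (0:ℝ)..t, b τ := by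
    intro b hb hle t ht ξ hξ
    refine ContinuousOn.le_of_ae_restrict_le (f := fun ξ => ‖σ₁ t ξ - σ₂ t ξ‖)
      ((h₁ t ht).continuousOn.sub (h₂ t ht).continuousOn).norm ?_ hξ
    filter_upwards [he₁ t ht, he₂ t ht, ae_restrict_mem measurableSet_Ioc] with ξ e₁ e₂ hξ
    have hξ' := Ioc_subset_Icc_self hξ
    have hsub : uIcc 0 t ⊆ Icc 0 T := by
      rw [uIcc_of_le ht.1]
      exact Icc_subset_Icc_right ht.2
    rw [e₁, e₂, add_sub_add_left_eq_sub, ← intervalIntegral.integral_sub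
      ((hK.continuousOn_integral h₁ hm₁ hC₁ hξ').mono hsub).intervalIntegrable
      ((hK.continuousOn_integral h₂ hm₂ hC₂ hξ').mono hsub).intervalIntegrable]
    refine intervalIntegral.norm_integral_le_of_norm_le ht.1
      (Filter.Eventually.of_forall fun τ hτ => ?_) (hb.intervalIntegrable _ _)
    exact hle τ ⟨hτ.1.le, hτ.2.trans ht.2⟩ ξ hξ'
  have iter : ∀ n : ℕ, ∀ t ∈ Icc 0 T, ∀ ξ ∈ Icc (0:ℝ) 1,
      ‖σ₁ t ξ - σ₂ t ξ‖ ≤ 2 * (B * m) * T * ((3 * (B * m) * t) ^ n / n.factorial) := by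
    intro n
    induction n with
    | zero =>
      intro t ht ξ hξ
      refine (step (fun _ => 2 * (B * m)) continuous_const (fun τ hτ ξ hξ => ?_) t ht ξ hξ).trans ?_
      · refine (_root_.norm_sub_le _ _).trans ?_
        linarith [hK.norm_integral_le (σ := σ₁ τ) (h₁ τ hτ).intervalIntegrable (hm₁ τ hτ) (σ₁ τ ξ),
          hK.norm_integral_le (σ := σ₂ τ) (h₂ τ hτ).intervalIntegrable (hm₂ τ hτ) (σ₂ τ ξ)]
      · have := mul_le_mul_of_nonneg_left ht.2 (by positivity : 0 ≤ 2 * (B * m))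
        simp only [intervalIntegral.integral_const, sub_zero, smul_eq_mul, pow_zero,
          Nat.factorial_zero, Nat.cast_one, div_one, mul_one]
        linarith
    | succ n ih =>
      intro t ht ξ hξ
      refine (step (fun τ => B * m * (3 * (2 * (B * m) * T *
        ((3 * (B * m) * τ) ^ n / n.factorial)))) (by fun_prop)
        (fun τ hτ ξ hξ => ?_) t ht ξ hξ).trans ?_
      · refine (hK.norm_integral_sub_le (h₁ τ hτ) (h₂ τ hτ) (hm₁ τ hτ) (hm₂ τ hτ)
          (ih τ hτ) _ _).trans ?_
        refine mul_le_mul_of_nonneg_left ?_ (by positivity)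
        linarith [ih τ hτ ξ hξ]
      · refine le_of_eq ?_
        have e : ∀ τ : ℝ, B * m * (3 * (2 * (B * m) * T *
            ((3 * (B * m) * τ) ^ n / n.factorial))) =
            (2 * (B * m) * T * (3 * (B * m)) ^ (n + 1) / n.factorial) * τ ^ n := by
          intro τ
          rw [mul_pow _ τ, pow_succ]
          ring
        simp_rw [e]
        rw [intervalIntegral.integral_const_mul, integral_pow, mul_pow _ t, Nat.factorial_succ]
        have : (n.factorial : ℝ) ≠ 0 := by positivity
        push_cast
        field_simp
        simp
  have hlim := (FloorSemiring.tendsto_pow_div_factorial_atTop (3 * (B * m) * t)).const_mul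
    (2 * (B * m) * T)
  rw [mul_zero] at hlim
  have h0 := ge_of_tendsto' hlim fun n => iter n t ht ξ hξ
  exact sub_eq_zero.1 (norm_le_zero_iff.1 h0)

end IsSmoothKernel

/-- Uniqueness of global filament solutions. -/
lemma IsGlobalFilamentSolution.eq {φ : E3 → ℝ} {μ : Measure E3} (hφ : IsCosineTransform φ μ)
    {γ₀ : ℝ → E3} {γ₁ γ₂ : ℝ → ℝ → E3} (h₁ : IsGlobalFilamentSolution φ γ₀ γ₁)
    (h₂ : IsGlobalFilamentSolution φ γ₀ γ₂) {t : ℝ} (ht : 0 ≤ t) {ξ : ℝ} (hξ : ξ ∈ Icc (0:ℝ) 1) :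
    γ₁ t ξ = γ₂ t ξ := by
  obtain ⟨B, K', hK⟩ := hφ.exists_isSmoothKernel
  obtain ⟨d₁, l₁, b₁, c₁, e₁⟩ := h₁
  obtain ⟨d₂, l₂, b₂, c₂, e₂⟩ := h₂
  obtain ⟨M₁, hM₁⟩ := b₁ t ht
  obtain ⟨M₂, hM₂⟩ := b₂ t ht
  obtain ⟨L₁, hL₁⟩ := c₁ t ht
  obtain ⟨L₂, hL₂⟩ := c₂ t ht
  obtain ⟨C₁, hC₁⟩ := exists_norm_sub_sq_le (fun s hs => l₁ s hs.1) hM₁ hL₁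
  obtain ⟨C₂, hC₂⟩ := exists_norm_sub_sq_le (fun s hs => l₂ s hs.1) hM₂ hL₂
  refine hK.eq_of_integral_eq (m := 1 + max M₁ M₂) (fun s hs => l₁ s hs.1) (fun s hs => l₂ s hs.1)
    (fun s hs => (l₁ s hs.1).integral_norm_le ((hM₁ s hs).trans (le_max_left _ _)))
    (fun s hs => (l₂ s hs.1).integral_norm_le ((hM₂ s hs).trans (le_max_right _ _)))
    hC₁ hC₂ (fun s hs => e₁ s hs.1) (fun s hs => e₂ s hs.1) ⟨ht, le_rfl⟩ hξ

section ODE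

variable {Y : Type*} [NormedAddCommGroup Y]

/-- A cutoff function, equal to one on the ball of radius `R` and vanishing outside the ball of
radius `R + 1`. -/
def radialCutoff (R : ℝ) (y : Y) : ℝ := max 0 (min 1 (R + 1 - ‖y‖))

lemma radialCutoff_nonneg (R : ℝ) (y : Y) : 0 ≤ radialCutoff R y := le_max_left _ _

lemma radialCutoff_le_one (R : ℝ) (y : Y) : radialCutoff R y ≤ 1 :=
  max_le zero_le_one (min_le_left _ _)

lemma radialCutoff_eq_one {R : ℝ} {y : Y} (h : ‖y‖ ≤ R) : radialCutoff R y = 1 := by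
  rw [radialCutoff, min_eq_left (by linarith), max_eq_right zero_le_one]

lemma radialCutoff_eq_zero {R : ℝ} {y : Y} (h : R + 1 < ‖y‖) : radialCutoff R y = 0 :=
  max_eq_left ((min_le_right _ _).trans (by linarith))

lemma abs_radialCutoff_sub_le (R : ℝ) (x y : Y) :
    |radialCutoff R x - radialCutoff R y| ≤ ‖x - y‖ := by
  have h1 := abs_le.1 (abs_norm_sub_norm_le x y)
  have h2 := norm_nonneg (x - y)
  simp only [radialCutoff, max_def, min_def]
  rw [abs_le]
  split_ifs <;> constructor <;> linarith

variable [NormedSpace ℝ Y]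

/-- Truncating a locally Lipschitz vector field makes it bounded and globally Lipschitz. -/
lemma exists_bound_radialCutoff_smul {F : Y → Y}
    (hF : ∀ R : ℝ, ∃ L : NNReal, LipschitzOnWith L F (Metric.closedBall 0 R)) (R : ℝ) :
    ∃ N L : NNReal, (∀ y, ‖radialCutoff R y • F y‖ ≤ N) ∧
      LipschitzWith L fun y => radialCutoff R y • F y := by
  obtain ⟨L, hL⟩ := hF (R + 1)
  have hbd : ∃ N : NNReal, ∀ y ∈ Metric.closedBall (0:Y) (R + 1), ‖F y‖ ≤ N := by
    refine ⟨(‖F 0‖ + L * (R + 1)).toNNReal, fun y hy => le_trans ?_ (Real.le_coe_toNNReal _)⟩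
    have hy' : ‖y‖ ≤ R + 1 := by simpa using hy
    have h := hL.dist_le_mul y hy 0 (by simpa using (norm_nonneg y).trans hy')
    rw [dist_eq_norm, dist_zero_right] at h
    have := norm_le_norm_add_norm_sub' (F y) (F 0)
    have := mul_le_mul_of_nonneg_left hy' L.2
    simp only [NNReal.val_eq_coe] at this
    linarith
  obtain ⟨N, hN⟩ := hbd
  have hout : ∀ y ∉ Metric.closedBall (0:Y) (R + 1), radialCutoff R y = 0 := fun y hy =>
    radialCutoff_eq_zero (by simpa using hy)
  refine ⟨N, N + L, fun y => ?_, ?_⟩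
  · by_cases hy : y ∈ Metric.closedBall (0:Y) (R + 1)
    · rw [norm_smul, Real.norm_of_nonneg (radialCutoff_nonneg R y)]
      exact (mul_le_of_le_one_left (norm_nonneg _) (radialCutoff_le_one R y)).trans (hN y hy)
    · simp [hout y hy]
  have main : ∀ x ∈ Metric.closedBall (0:Y) (R + 1), ∀ y,
      ‖radialCutoff R x • F x - radialCutoff R y • F y‖ ≤ (N + L) * ‖x - y‖ := by
    intro x hx y
    have h1 : ‖(radialCutoff R x - radialCutoff R y) • F x‖ ≤ N * ‖x - y‖ := by
      rw [norm_smul, mul_comm]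
      exact mul_le_mul (hN x hx) (abs_radialCutoff_sub_le R x y) (norm_nonneg _) N.2
    by_cases hy : y ∈ Metric.closedBall (0:Y) (R + 1)
    · have h2 : ‖radialCutoff R y • (F x - F y)‖ ≤ L * ‖x - y‖ := by
        rw [norm_smul, Real.norm_of_nonneg (radialCutoff_nonneg R y)]
        refine (mul_le_of_le_one_left (norm_nonneg _) (radialCutoff_le_one R y)).trans ?_
        simpa [dist_eq_norm] using hL.dist_le_mul x hx y hy
      calc _ = ‖(radialCutoff R x - radialCutoff R y) • F x
              + radialCutoff R y • (F x - F y)‖ := by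
            rw [sub_smul, smul_sub]
            abel_nf
        _ ≤ _ := (norm_add_le _ _).trans (by linarith)
    · rw [hout y hy] at h1 ⊢
      rw [sub_zero] at h1
      rw [zero_smul, sub_zero]
      exact h1.trans (mul_le_mul_of_nonneg_right (le_add_of_nonneg_right L.2) (norm_nonneg _))
  refine LipschitzWith.of_dist_le_mul fun x y => ?_
  rw [dist_eq_norm, dist_eq_norm, NNReal.coe_add]
  by_cases hx : x ∈ Metric.closedBall (0:Y) (R + 1)
  · exact main x hx y
  by_cases hy : y ∈ Metric.closedBall (0:Y) (R + 1)
  · rw [norm_sub_rev, norm_sub_rev x]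
    exact main y hy x
  · rw [hout x hx, hout y hy]
    simp only [zero_smul, sub_zero, norm_zero]
    positivity

/-- An autonomous bounded Lipschitz vector field has integral curves on any time interval. -/
lemma exists_integralCurve_of_bounded [CompleteSpace Y] {G : Y → Y} {N L : NNReal}
    (hN : ∀ y, ‖G y‖ ≤ N) (hL : LipschitzWith L G) (y₀ : Y) {T : ℝ} (hT : 0 ≤ T) :
    ∃ α : ℝ → Y, α 0 = y₀ ∧ ∀ t ∈ Ioo (-T) T, HasDerivAt α (G (α t)) t := by
  have hPL : IsPicardLindelof (fun _ => G) (tmin := -T) (tmax := T)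
      ⟨0, by constructor <;> linarith⟩ y₀ (N * T.toNNReal) 0 N L :=
    { lipschitzOnWith := fun _ _ => hL.lipschitzOnWith
      continuousOn := fun _ _ => continuousOn_const
      norm_le := fun _ _ x _ => hN x
      mul_max_le := by simp [hT] }
  obtain ⟨α, h0, hα⟩ := hPL.exists_eq_forall_mem_Icc_hasDerivWithinAt₀
  exact ⟨α, h0, fun t ht => (hα t (Ioo_subset_Icc_self ht)).hasDerivAt (Icc_mem_nhds ht.1 ht.2)⟩

/-- Global forward existence for a locally Lipschitz vector field, under an a priori bound for
the integral curves of its time-dependent contractions. -/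
theorem exists_forward_integralCurve_of_bound [CompleteSpace Y] {F : Y → Y}
    (hF : ∀ R : ℝ, ∃ L : NNReal, LipschitzOnWith L F (Metric.closedBall 0 R)) (y₀ : Y)
    (hbd : ∀ T : ℝ, 0 < T → ∃ R : ℝ, ∀ θ : ℝ → ℝ, (∀ t, 0 ≤ θ t ∧ θ t ≤ 1) →
      ∀ α : ℝ → Y, α 0 = y₀ → (∀ t ∈ Ioo (-T) T, HasDerivAt α (θ t • F (α t)) t) →
        ∀ t ∈ Ico 0 T, ‖α t‖ ≤ R) :
    ∃ α : ℝ → Y, α 0 = y₀ ∧ ContinuousOn α (Ici 0) ∧ ∀ t > 0, HasDerivAt α (F (α t)) t := by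
  have hloc : ∀ n : ℕ, ∃ (R : ℝ) (α : ℝ → Y), α 0 = y₀ ∧ ContinuousOn α (Ico 0 (n + 1)) ∧
      ∀ t ∈ Ico (0:ℝ) (n + 1), ‖α t‖ ≤ R ∧ HasDerivAt α (F (α t)) t := by
    intro n
    obtain ⟨R, hR⟩ := hbd (n + 1) (by positivity)
    obtain ⟨N, L, hN, hL⟩ := exists_bound_radialCutoff_smul hF R
    obtain ⟨α, h0, hα⟩ := exists_integralCurve_of_bounded hN hL y₀ (T := n + 1) (by positivity)
    have hsub : Ico (0:ℝ) (n + 1) ⊆ Ioo (-(n + 1 : ℝ)) (n + 1) := fun t ht =>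
      ⟨by linarith [ht.1, ht.2], ht.2⟩
    have hle := hR (fun t => radialCutoff R (α t))
      (fun t => ⟨radialCutoff_nonneg R _, radialCutoff_le_one R _⟩) α h0 hα
    refine ⟨R, α, h0, fun t ht => (hα t (hsub ht)).continuousAt.continuousWithinAt,
      fun t ht => ⟨hle t ht, ?_⟩⟩
    have := hα t (hsub ht)
    rwa [radialCutoff_eq_one (hle t ht), one_smul] at this
  choose R α h0 hc hα using hloc
  have huniq : ∀ m n : ℕ, ∀ t : ℝ, 0 ≤ t → t < m + 1 → t < n + 1 → α m t = α n t := by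
    intro m n t ht htm htn
    obtain ⟨L, hL⟩ := hF (max (R m) (R n))
    have hm : ∀ s ∈ Icc 0 t, s ∈ Ico (0:ℝ) (m + 1) := fun s hs => ⟨hs.1, hs.2.trans_lt htm⟩
    have hn : ∀ s ∈ Icc 0 t, s ∈ Ico (0:ℝ) (n + 1) := fun s hs => ⟨hs.1, hs.2.trans_lt htn⟩
    refine ODE_solution_unique_of_mem_Icc_right (v := fun _ => F) (K := L)
      (s := fun _ => Metric.closedBall 0 (max (R m) (R n))) (fun _ _ => hL)
      ((hc m).mono hm) (fun s hs => ?_) (fun s hs => ?_) ((hc n).mono hn) (fun s hs => ?_)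
      (fun s hs => ?_) ((h0 m).trans (h0 n).symm) ⟨ht, le_rfl⟩
    · exact (hα m s (hm s (Ico_subset_Icc_self hs))).2.hasDerivWithinAt
    · simpa using Or.inl (hα m s (hm s (Ico_subset_Icc_self hs))).1
    · exact (hα n s (hn s (Ico_subset_Icc_self hs))).2.hasDerivWithinAt
    · simpa using Or.inr (hα n s (hn s (Ico_subset_Icc_self hs))).1
  have heq : ∀ n : ℕ, ∀ t ∈ Ico (0:ℝ) (n + 1), α ⌊t⌋₊ t = α n t := fun n t ht =>
    huniq _ n t ht.1 (Nat.lt_floor_add_one t) ht.2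
  refine ⟨fun t => α ⌊t⌋₊ t, by simp [h0], fun t ht => ?_, fun t ht => ?_⟩
  · have ht' : t ∈ Ico (0:ℝ) (⌊t⌋₊ + 1) := ⟨ht, Nat.lt_floor_add_one t⟩
    have h1 : ContinuousWithinAt (α ⌊t⌋₊) (Ici 0) t :=
      (hα _ t ht').2.continuousAt.continuousWithinAt
    refine h1.congr_of_eventuallyEq ?_ (heq _ t ht')
    filter_upwards [self_mem_nhdsWithin, mem_nhdsWithin_of_mem_nhds (Iio_mem_nhds ht'.2)]
      with s hs hs'
    exact heq _ s ⟨hs, hs'⟩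
  · have ht' : t ∈ Ico (0:ℝ) (⌊t⌋₊ + 1) := ⟨ht.le, Nat.lt_floor_add_one t⟩
    refine (hα _ t ht').2.congr_of_eventuallyEq ?_
    filter_upwards [Ioo_mem_nhds ht ht'.2] with s hs
    exact heq _ s ⟨hs.1.le, hs.2⟩

end ODE

section Kernel

variable {Z : Type*} [NormedAddCommGroup Z] [NormedSpace ℝ Z]

/-- The field induced at `x` by a curve `γ` with tangent `v`, for a general kernel `Φ`. -/
def inducedField (Φ : E3 → E3 →L[ℝ] Z) (γ v : ℝ → E3) (x : E3) : Z :=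
  ∫ η in (0:ℝ)..1, Φ (x - γ η) (v η)

variable {Φ : E3 → E3 →L[ℝ] Z} {B : ℝ}

lemma norm_inducedField_le (hB : 0 ≤ B) (hΦ : ∀ x, ‖Φ x‖ ≤ B) {γ v : ℝ → E3}
    {m : ℝ} (hv : IntervalIntegrable v volume 0 1) (hm : ∫ η in (0:ℝ)..1, ‖v η‖ ≤ m) (x : E3) :
    ‖inducedField Φ γ v x‖ ≤ B * m := by
  have b : ‖inducedField Φ γ v x‖ ≤ ∫ η in (0:ℝ)..1, B * ‖v η‖ := by
    refine intervalIntegral.norm_integral_le_of_norm_le zero_le_one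
      (Filter.Eventually.of_forall fun η hη => ?_) (hv.norm.const_mul _)
    exact (ContinuousLinearMap.le_opNorm _ _).trans (by gcongr; exact hΦ _)
  rw [intervalIntegral.integral_const_mul] at b
  exact b.trans (mul_le_mul_of_nonneg_left hm hB)

lemma intervalIntegrable_inducedField (hc : Continuous Φ) {γ v : ℝ → E3}
    (hγ : ContinuousOn γ (Icc 0 1)) (hv : IntervalIntegrable v volume 0 1) (x : E3) :
    IntervalIntegrable (fun η => Φ (x - γ η) (v η)) volume 0 1 :=
  (hc.comp_continuousOn (continuousOn_const.sub hγ)).intervalIntegrable_clm_apply hv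

lemma norm_inducedField_sub_le (hΦ : ∀ x, ‖Φ x‖ ≤ B)
    (hΦ' : ∀ x y, ‖Φ x - Φ y‖ ≤ B * ‖x - y‖) (hc : Continuous Φ) {γ₁ v₁ γ₂ v₂ : ℝ → E3}
    (hγ₁ : ContinuousOn γ₁ (Icc 0 1)) (hγ₂ : ContinuousOn γ₂ (Icc 0 1))
    (hv₁ : IntervalIntegrable v₁ volume 0 1) (hv₂ : IntervalIntegrable v₂ volume 0 1)
    {m n D : ℝ} (hm : ∫ η in (0:ℝ)..1, ‖v₁ η‖ ≤ m) (hn : ∫ η in (0:ℝ)..1, ‖v₁ η - v₂ η‖ ≤ n)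
    (hD : ∀ η ∈ Icc (0:ℝ) 1, ‖γ₁ η - γ₂ η‖ ≤ D) (x₁ x₂ : E3) :
    ‖inducedField Φ γ₁ v₁ x₁ - inducedField Φ γ₂ v₂ x₂‖ ≤
      B * (‖x₁ - x₂‖ + D) * m + B * n := by
  have hB : 0 ≤ B := (norm_nonneg _).trans (hΦ 0)
  have hD0 : 0 ≤ D := (norm_nonneg _).trans (hD 0 (by simp))
  have split : inducedField Φ γ₁ v₁ x₁ - inducedField Φ γ₂ v₂ x₂ =
      (∫ η in (0:ℝ)..1, (Φ (x₁ - γ₁ η) - Φ (x₂ - γ₂ η)) (v₁ η)) +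
        inducedField Φ γ₂ (fun η => v₁ η - v₂ η) x₂ := by
    have i₁ := intervalIntegrable_inducedField hc hγ₁ hv₁ x₁
    have i₂ := intervalIntegrable_inducedField hc hγ₂ hv₂ x₂
    have i₃ := intervalIntegrable_inducedField hc hγ₂ hv₁ x₂
    simp only [inducedField, sub_apply, map_sub]
    rw [intervalIntegral.integral_sub i₁ i₃, intervalIntegral.integral_sub i₃ i₂]
    abel
  have b₁ : ‖∫ η in (0:ℝ)..1, (Φ (x₁ - γ₁ η) - Φ (x₂ - γ₂ η)) (v₁ η)‖ ≤
      ∫ η in (0:ℝ)..1, B * (‖x₁ - x₂‖ + D) * ‖v₁ η‖ := by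
    refine intervalIntegral.norm_integral_le_of_norm_le zero_le_one
      (Filter.Eventually.of_forall fun η hη => ?_) (hv₁.norm.const_mul _)
    refine (ContinuousLinearMap.le_opNorm _ _).trans ?_
    gcongr
    refine (hΦ' _ _).trans ?_
    gcongr
    calc ‖x₁ - γ₁ η - (x₂ - γ₂ η)‖ = ‖(x₁ - x₂) - (γ₁ η - γ₂ η)‖ := by congr 1; abel
      _ ≤ _ := (norm_sub_le _ _).trans (by gcongr; exact hD η (Ioc_subset_Icc_self hη))
  rw [intervalIntegral.integral_const_mul] at b₁
  have c₁ := mul_le_mul_of_nonneg_left hm (by positivity : 0 ≤ B * (‖x₁ - x₂‖ + D))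
  rw [split]
  exact (norm_add_le _ _).trans
    (add_le_add (b₁.trans c₁) (norm_inducedField_le hB hΦ (hv₁.sub hv₂) hn x₂))

lemma continuous_inducedField (hΦ : ∀ x, ‖Φ x‖ ≤ B)
    (hΦ' : ∀ x y, ‖Φ x - Φ y‖ ≤ B * ‖x - y‖) (hc : Continuous Φ) {γ v : ℝ → E3}
    (hγ : ContinuousOn γ (Icc 0 1)) (hv : IntervalIntegrable v volume 0 1) :
    Continuous (inducedField Φ γ v) := by
  have hB : 0 ≤ B := (norm_nonneg _).trans (hΦ 0)
  have hm : 0 ≤ ∫ η in (0:ℝ)..1, ‖v η‖ :=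
    intervalIntegral.integral_nonneg zero_le_one fun _ _ => norm_nonneg _
  have h : LipschitzWith ⟨B * ∫ η in (0:ℝ)..1, ‖v η‖, by positivity⟩ (inducedField Φ γ v) := by
    refine LipschitzWith.of_dist_le_mul fun x y => ?_
    rw [dist_eq_norm, dist_eq_norm]
    refine (norm_inducedField_sub_le hΦ hΦ' hc hγ hγ hv hv le_rfl (n := 0) (D := 0) (by simp)
      (by simp) x y).trans (le_of_eq ?_)
    change _ = B * (∫ η in (0:ℝ)..1, ‖v η‖) * ‖x - y‖
    ring
  exact h.continuous

end Kernel

/-- The kernel of the derivative of the induced velocity. -/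
def derivKernel (K' : E3 → E3 →L[ℝ] E3 →L[ℝ] E3) (x : E3) : E3 →L[ℝ] E3 →L[ℝ] E3 := (K' x).flip

namespace IsSmoothKernel

variable {K : E3 → E3 →L[ℝ] E3} {K' : E3 → E3 →L[ℝ] E3 →L[ℝ] E3} {B : ℝ}

lemma norm_derivKernel_le (hK : IsSmoothKernel K K' B) (x : E3) : ‖derivKernel K' x‖ ≤ B := by
  rw [derivKernel, ContinuousLinearMap.opNorm_flip]
  exact hK.norm_deriv_le x

lemma norm_derivKernel_sub_le (hK : IsSmoothKernel K K' B) (x y : E3) :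
    ‖derivKernel K' x - derivKernel K' y‖ ≤ B * ‖x - y‖ := by
  have : derivKernel K' x - derivKernel K' y = (K' x - K' y).flip := rfl
  rw [this, ContinuousLinearMap.opNorm_flip]
  exact hK.norm_deriv_sub_le x y

lemma continuous_derivKernel (hK : IsSmoothKernel K K' B) : Continuous (derivKernel K') :=
  (ContinuousLinearMap.flipₗᵢ ℝ E3 E3 E3).continuous.comp hK.continuous_deriv

/-- The derivative of the induced velocity. -/
lemma hasFDerivAt_inducedField (hK : IsSmoothKernel K K' B) {γ v : ℝ → E3}
    (hγ : ContinuousOn γ (Icc 0 1)) (hv : IntervalIntegrable v volume 0 1) (x : E3) :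
    HasFDerivAt (inducedField K γ v) (inducedField (derivKernel K') γ v x) x := by
  refine (intervalIntegral.hasFDerivAt_integral_of_dominated_of_fderiv_le (s := univ)
    (bound := fun η => B * ‖v η‖) (F := fun x η => K (x - γ η) (v η))
    (F' := fun x η => derivKernel K' (x - γ η) (v η)) Filter.univ_mem
    (Filter.Eventually.of_forall fun y => ?_)
    (intervalIntegrable_inducedField hK.continuous hγ hv x) ?_
    (Filter.Eventually.of_forall fun η _ y _ => ?_) (hv.norm.const_mul B)
    (Filter.Eventually.of_forall fun η _ y _ => ?_))
  · exact (intervalIntegrable_inducedField hK.continuous hγ hv y).def'.1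
  · exact (intervalIntegrable_inducedField hK.continuous_derivKernel hγ hv
      x).def'.1
  · exact (ContinuousLinearMap.le_opNorm _ _).trans
      (by gcongr; exact hK.norm_derivKernel_le _)
  · have h1 : HasFDerivAt (fun y => K (y - γ η)) (K' (y - γ η)) y := by
      refine ((hK.hasFDerivAt (y - γ η)).comp y
        ((hasFDerivAt_id y).sub_const (γ η))).congr_fderiv ?_
      exact ContinuousLinearMap.comp_id _
    refine (h1.clm_apply (hasFDerivAt_const (v η) y)).congr_fderiv ?_
    ext z
    simp [derivKernel]

end IsSmoothKernel

/-- States of the Lagrangian formulation: the base point of the curve and the field of matrices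
which transport the initial tangent. -/
def FilamentState : Type := E3 × (ℝ →ᵇ (E3 →L[ℝ] E3))

namespace FilamentState

instance : NormedAddCommGroup FilamentState :=
  inferInstanceAs (NormedAddCommGroup (E3 × (ℝ →ᵇ (E3 →L[ℝ] E3))))

instance : NormedSpace ℝ FilamentState :=
  inferInstanceAs (NormedSpace ℝ (E3 × (ℝ →ᵇ (E3 →L[ℝ] E3))))

instance : CompleteSpace FilamentState :=
  inferInstanceAs (CompleteSpace (E3 × (ℝ →ᵇ (E3 →L[ℝ] E3))))

lemma norm_fst_le (y : FilamentState) : ‖y.1‖ ≤ ‖y‖ := le_max_left _ _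

lemma norm_snd_apply_le (y : FilamentState) (s : ℝ) : ‖y.2 s‖ ≤ ‖y‖ :=
  (y.2.norm_coe_le_norm s).trans (le_max_right _ _)

lemma norm_le_of_forall {y : FilamentState} {C : ℝ} (h₁ : ‖y.1‖ ≤ C) (h₂ : ∀ s, ‖y.2 s‖ ≤ C) :
    ‖y‖ ≤ C :=
  max_le h₁ ((BoundedContinuousFunction.norm_le ((norm_nonneg _).trans h₁)).2 h₂)

variable {g : ℝ → E3}

/-- The tangent of the curve described by a state. -/
def tangent (g : ℝ → E3) (y : FilamentState) (s : ℝ) : E3 := y.2 s (g s)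

lemma norm_tangent_le (y : FilamentState) (s : ℝ) : ‖tangent g y s‖ ≤ ‖y‖ * ‖g s‖ :=
  (ContinuousLinearMap.le_opNorm _ _).trans (by
    gcongr
    exact norm_snd_apply_le y s)

lemma integrable_tangent (hg : Integrable g) (y : FilamentState) : Integrable (tangent g y) := by
  refine Integrable.mono' (hg.norm.const_mul ‖y‖) ?_
    (Filter.Eventually.of_forall fun s => norm_tangent_le y s)
  exact (ContinuousLinearMap.apply ℝ E3 :
    E3 →L[ℝ] (E3 →L[ℝ] E3) →L[ℝ] E3).aestronglyMeasurable_comp₂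
    hg.1 y.2.continuous.aestronglyMeasurable

lemma norm_integral_tangent_le (hg : Integrable g) (y : FilamentState) (a b : ℝ) :
    ‖∫ s in a..b, tangent g y s‖ ≤ (∫ s, ‖g s‖) * ‖y‖ := by
  refine intervalIntegral.norm_integral_le_integral_norm_uIoc.trans ?_
  calc ∫ s in uIoc a b, ‖tangent g y s‖ ≤ ∫ s, ‖tangent g y s‖ :=
        setIntegral_le_integral (integrable_tangent hg y).norm
          (Filter.Eventually.of_forall fun _ => norm_nonneg _)
    _ ≤ ∫ s, ‖g s‖ * ‖y‖ :=
        integral_mono (integrable_tangent hg y).norm (hg.norm.mul_const _) fun s =>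
          (norm_tangent_le y s).trans (mul_comm _ _).le
    _ = _ := integral_mul_const _ _

lemma integral_norm_tangent_le (hg : Integrable g) (y : FilamentState) :
    ∫ s in (0:ℝ)..1, ‖tangent g y s‖ ≤ (∫ s, ‖g s‖) * ‖y‖ := by
  rw [intervalIntegral.integral_of_le zero_le_one]
  calc ∫ s in Ioc (0:ℝ) 1, ‖tangent g y s‖ ≤ ∫ s, ‖tangent g y s‖ :=
        setIntegral_le_integral (integrable_tangent hg y).norm
          (Filter.Eventually.of_forall fun _ => norm_nonneg _)
    _ ≤ ∫ s, ‖g s‖ * ‖y‖ :=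
        integral_mono (integrable_tangent hg y).norm (hg.norm.mul_const _) fun s =>
          (norm_tangent_le y s).trans (mul_comm _ _).le
    _ = _ := integral_mul_const _ _

/-- The point of parameter `ξ` of the curve described by a state. -/
def curve (hg : Integrable g) (ξ : ℝ) : FilamentState →L[ℝ] E3 :=
  LinearMap.mkContinuous
    { toFun := fun y => y.1 + ∫ s in (0:ℝ)..ξ, tangent g y s
      map_add' := fun x y => by
        have : ∀ s, tangent g (x + y) s = tangent g x s + tangent g y s := fun _ => rfl
        simp_rw [this]
        rw [intervalIntegral.integral_add (integrable_tangent hg x).intervalIntegrable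
          (integrable_tangent hg y).intervalIntegrable]
        exact add_add_add_comm _ _ _ _
      map_smul' := fun c y => by
        have : ∀ s, tangent g (c • y) s = c • tangent g y s := fun _ => rfl
        simp_rw [this]
        rw [intervalIntegral.integral_smul]
        exact (smul_add c y.1 _).symm }
    (1 + ∫ s, ‖g s‖) fun y => by
      rw [add_mul, one_mul]
      exact (norm_add_le _ _).trans (add_le_add (norm_fst_le y) (norm_integral_tangent_le hg y 0 ξ))

lemma curve_apply (hg : Integrable g) (ξ : ℝ) (y : FilamentState) :
    curve hg ξ y = y.1 + ∫ s in (0:ℝ)..ξ, tangent g y s := rfl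

lemma curve_zero (hg : Integrable g) (y : FilamentState) : curve hg 0 y = y.1 := by
  simp [curve_apply]

lemma curve_eq_add_integral (hg : Integrable g) (ξ : ℝ) (y : FilamentState) :
    curve hg ξ y = curve hg 0 y + ∫ s in (0:ℝ)..ξ, tangent g y s := by
  rw [curve_zero, curve_apply]

lemma norm_curve_le (hg : Integrable g) (ξ : ℝ) (y : FilamentState) :
    ‖curve hg ξ y‖ ≤ (1 + ∫ s, ‖g s‖) * ‖y‖ := by
  rw [add_mul, one_mul]
  exact (norm_add_le _ _).trans (add_le_add (norm_fst_le y) (norm_integral_tangent_le hg y 0 ξ))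

lemma continuous_curve (hg : Integrable g) (y : FilamentState) :
    Continuous fun ξ => curve hg ξ y :=
  continuous_const.add (intervalIntegral.continuous_primitive
    (fun _ _ => (integrable_tangent hg y).intervalIntegrable) 0)

end FilamentState

namespace FilamentState

variable {g : ℝ → E3}

section StateField

variable {Z : Type*} [NormedAddCommGroup Z] [NormedSpace ℝ Z]

/-- The field with kernel `Φ` induced by the curve described by a state. -/
def stateField (Φ : E3 → E3 →L[ℝ] Z) (hg : Integrable g) (y : FilamentState) : E3 → Z :=
  inducedField Φ (fun ξ => curve hg ξ y) (tangent g y)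

variable {Φ : E3 → E3 →L[ℝ] Z} {B : ℝ}

lemma norm_stateField_le (hB : 0 ≤ B) (hΦ : ∀ x, ‖Φ x‖ ≤ B) (hg : Integrable g)
    (y : FilamentState) (x : E3) : ‖stateField Φ hg y x‖ ≤ B * ((∫ s, ‖g s‖) * ‖y‖) :=
  norm_inducedField_le hB hΦ (integrable_tangent hg y).intervalIntegrable
    (integral_norm_tangent_le hg y) x

lemma continuous_stateField (hΦ : ∀ x, ‖Φ x‖ ≤ B) (hΦ' : ∀ x y, ‖Φ x - Φ y‖ ≤ B * ‖x - y‖)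
    (hc : Continuous Φ) (hg : Integrable g) (y : FilamentState) :
    Continuous (stateField Φ hg y) :=
  continuous_inducedField hΦ hΦ' hc (continuous_curve hg y).continuousOn
    (integrable_tangent hg y).intervalIntegrable

lemma norm_stateField_sub_le (hΦ : ∀ x, ‖Φ x‖ ≤ B) (hΦ' : ∀ x y, ‖Φ x - Φ y‖ ≤ B * ‖x - y‖)
    (hc : Continuous Φ) (hg : Integrable g) {y₁ y₂ : FilamentState} {R : ℝ}
    (h₁ : ‖y₁‖ ≤ R) (x₁ x₂ : E3) :
    ‖stateField Φ hg y₁ x₁ - stateField Φ hg y₂ x₂‖ ≤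
      B * (‖x₁ - x₂‖ + (1 + ∫ s, ‖g s‖) * ‖y₁ - y₂‖) * ((∫ s, ‖g s‖) * R) +
        B * ((∫ s, ‖g s‖) * ‖y₁ - y₂‖) := by
  have hG : 0 ≤ ∫ s, ‖g s‖ := integral_nonneg fun _ => norm_nonneg _
  refine norm_inducedField_sub_le hΦ hΦ' hc (continuous_curve hg y₁).continuousOn
    (continuous_curve hg y₂).continuousOn (integrable_tangent hg y₁).intervalIntegrable
    (integrable_tangent hg y₂).intervalIntegrable
    ((integral_norm_tangent_le hg y₁).trans (by gcongr)) ?_ (fun ξ _ => ?_) x₁ x₂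
  · exact integral_norm_tangent_le hg (y₁ - y₂)
  · rw [← map_sub]
    exact norm_curve_le hg ξ _

end StateField

variable {K : E3 → E3 →L[ℝ] E3} {K' : E3 → E3 →L[ℝ] E3 →L[ℝ] E3} {B : ℝ}

lemma norm_transport_le (hK : IsSmoothKernel K K' B) (hg : Integrable g) (y : FilamentState)
    (ξ : ℝ) : ‖(stateField (derivKernel K') hg y (curve hg ξ y)).comp (y.2 ξ)‖ ≤
      B * ((∫ s, ‖g s‖) * ‖y‖) * ‖y‖ := by
  have hG : 0 ≤ ∫ s, ‖g s‖ := integral_nonneg fun _ => norm_nonneg _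
  have := hK.nonneg
  refine (ContinuousLinearMap.opNorm_comp_le _ _).trans ?_
  gcongr
  · exact norm_stateField_le hK.nonneg hK.norm_derivKernel_le hg y _
  · exact norm_snd_apply_le y ξ

/-- The Lagrangian vector field of the filament evolution. -/
def vectorField (hK : IsSmoothKernel K K' B) (hg : Integrable g) (y : FilamentState) :
    FilamentState :=
  (stateField K hg y y.1, BoundedContinuousFunction.ofNormedAddCommGroup
    (fun ξ => (stateField (derivKernel K') hg y (curve hg ξ y)).comp (y.2 ξ))
    (((continuous_stateField hK.norm_derivKernel_le hK.norm_derivKernel_sub_le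
      hK.continuous_derivKernel hg y).comp (continuous_curve hg y)).clm_comp y.2.continuous)
    _ (norm_transport_le hK hg y))

lemma hasFDerivAt_stateField (hK : IsSmoothKernel K K' B) (hg : Integrable g) (y : FilamentState)
    (x : E3) : HasFDerivAt (stateField K hg y) (stateField (derivKernel K') hg y x) x :=
  hK.hasFDerivAt_inducedField (continuous_curve hg y).continuousOn
    (integrable_tangent hg y).intervalIntegrable x

/-- The vector field moves the points of the curve with the induced velocity. -/
lemma curve_vectorField (hK : IsSmoothKernel K K' B) (hg : Integrable g) (y : FilamentState)
    {ξ : ℝ} (hξ : ξ ∈ Icc (0:ℝ) 1) :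
    curve hg ξ (vectorField hK hg y) = stateField K hg y (curve hg ξ y) := by
  rw [comp_eq_add_integral_of_eq_add_integral (hasFDerivAt_stateField hK hg y)
    (continuous_stateField hK.norm_derivKernel_le hK.norm_derivKernel_sub_le
      hK.continuous_derivKernel hg y) (integrable_tangent hg y).intervalIntegrable
    (γ := fun ξ => curve hg ξ y) (fun ξ _ => curve_eq_add_integral hg ξ y) hξ, curve_zero]
  rfl

lemma exists_lipschitzOnWith_vectorField (hK : IsSmoothKernel K K' B) (hg : Integrable g)
    (R : ℝ) : ∃ L : NNReal, LipschitzOnWith L (vectorField hK hg) (Metric.closedBall 0 R) := by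
  have hB := hK.nonneg
  set G := ∫ s, ‖g s‖ with hG
  have hG0 : 0 ≤ G := integral_nonneg fun _ => norm_nonneg _
  set S := B * (2 * (1 + G)) * (G * R) + B * G with hS
  refine ⟨(S + S * R + B * (G * R)).toNNReal, LipschitzOnWith.of_dist_le_mul fun y₁ h₁ y₂ h₂ => ?_⟩
  rw [Metric.mem_closedBall, dist_zero_right] at h₁ h₂
  have hR : 0 ≤ R := (norm_nonneg y₁).trans h₁
  have hS0 : 0 ≤ S := by positivity
  rw [Real.coe_toNNReal _ (by positivity), dist_eq_norm, dist_eq_norm]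
  set δ := ‖y₁ - y₂‖ with hδ
  have hδ0 : 0 ≤ δ := norm_nonneg (y₁ - y₂)
  have hcurve : ∀ ξ, ‖curve hg ξ y₁ - curve hg ξ y₂‖ ≤ (1 + G) * δ := fun ξ => by
    rw [← map_sub]
    exact norm_curve_le hg ξ _
  have hdiff : ∀ {r : ℝ}, r ≤ (1 + G) * δ →
      B * (r + (1 + G) * δ) * (G * R) + B * (G * δ) ≤ S * δ := by
    intro r hr
    calc _ ≤ B * ((1 + G) * δ + (1 + G) * δ) * (G * R) + B * (G * δ) := by gcongr
      _ = S * δ := by rw [hS]; ring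
  refine norm_le_of_forall ?_ fun ξ => ?_
  · have h := (norm_stateField_sub_le hK.norm_le hK.norm_sub_le hK.continuous hg (y₂ := y₂) h₁
      (curve hg 0 y₁) (curve hg 0 y₂)).trans (hdiff (hcurve 0))
    rw [curve_zero, curve_zero] at h
    refine h.trans ?_
    gcongr
    have : 0 ≤ S * R + B * (G * R) := by positivity
    linarith
  · change ‖(stateField (derivKernel K') hg y₁ (curve hg ξ y₁)).comp (y₁.2 ξ) -
      (stateField (derivKernel K') hg y₂ (curve hg ξ y₂)).comp (y₂.2 ξ)‖ ≤ _
    set D₁ := stateField (derivKernel K') hg y₁ (curve hg ξ y₁)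
    set D₂ := stateField (derivKernel K') hg y₂ (curve hg ξ y₂)
    have hD : ‖D₁ - D₂‖ ≤ S * δ := (norm_stateField_sub_le hK.norm_derivKernel_le
      hK.norm_derivKernel_sub_le hK.continuous_derivKernel hg h₁ _ _).trans (hdiff (hcurve ξ))
    have hD₂ : ‖D₂‖ ≤ B * (G * R) :=
      (norm_stateField_le hB hK.norm_derivKernel_le hg y₂ _).trans (by gcongr)
    have hA₁ : ‖y₁.2 ξ‖ ≤ R := (norm_snd_apply_le y₁ ξ).trans h₁
    have hA : ‖y₁.2 ξ - y₂.2 ξ‖ ≤ δ :=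
      norm_snd_apply_le (y₁ - y₂) ξ
    have e : D₁.comp (y₁.2 ξ) - D₂.comp (y₂.2 ξ) =
        (D₁ - D₂).comp (y₁.2 ξ) + D₂.comp (y₁.2 ξ - y₂.2 ξ) := by
      rw [ContinuousLinearMap.sub_comp, ContinuousLinearMap.comp_sub]
      abel
    calc _ ≤ ‖D₁ - D₂‖ * ‖y₁.2 ξ‖ + ‖D₂‖ * ‖y₁.2 ξ - y₂.2 ξ‖ := by
          rw [e]
          exact (norm_add_le _ _).trans (add_le_add (ContinuousLinearMap.opNorm_comp_le _ _)
            (ContinuousLinearMap.opNorm_comp_le _ _))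
      _ ≤ S * δ * R + B * (G * R) * δ := by gcongr
      _ ≤ (S + S * R + B * (G * R)) * δ := by nlinarith [mul_nonneg hS0 hδ0]

/-- The evaluation of the tangent as a continuous linear map. -/
def tangentL (g : ℝ → E3) (ξ : ℝ) : FilamentState →L[ℝ] E3 :=
  LinearMap.mkContinuous
    { toFun := fun y => tangent g y ξ
      map_add' := fun _ _ => rfl
      map_smul' := fun _ _ => rfl }
    ‖g ξ‖ fun y => (norm_tangent_le y ξ).trans (mul_comm _ _).le

end FilamentState

lemma inner_cross3_right_self (a b : E3) : inner ℝ a (cross3 b a) = 0 := by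
  simp only [inner_eq_sum3, cross3, cross_apply]
  simp
  ring

lemma inner_cross3_eq_inner_neg (a b c : E3) :
    inner ℝ a (cross3 b c) = inner ℝ (cross3 b a) (-c) := by
  simp only [inner_eq_sum3, cross3, cross_apply]
  simp
  ring

lemma cross3_cross3 (a b c : E3) :
    cross3 a (cross3 b c) = (inner ℝ a c : ℝ) • b - (inner ℝ a b : ℝ) • c := by
  ext i
  fin_cases i <;> simp [inner_eq_sum3, cross3, cross_apply] <;> ring

/-- The integral of the wave `c⟨k, ·⟩` along a curve `γ` with tangent `v`. -/
def mode (c : ℝ → ℝ) (γ v : ℝ → E3) (k : E3) : E3 := ∫ η in (0:ℝ)..1, c (inner ℝ k (γ η)) • v η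

section Mode

variable {γ v : ℝ → E3}

lemma intervalIntegrable_mode {c : ℝ → ℝ} (hc : Continuous c) (hγ : Continuous γ)
    (hv : Integrable v) (k : E3) :
    IntervalIntegrable (fun η => c (inner ℝ k (γ η)) • v η) volume 0 1 :=
  hv.intervalIntegrable.continuousOn_smul (by fun_prop)

lemma norm_mode_le {c : ℝ → ℝ} (hc1 : ∀ s, |c s| ≤ 1) (hv : Integrable v) (k : E3) :
    ‖mode c γ v k‖ ≤ ∫ η in (0:ℝ)..1, ‖v η‖ := by
  refine intervalIntegral.norm_integral_le_of_norm_le zero_le_one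
    (Filter.Eventually.of_forall fun η _ => ?_) hv.norm.intervalIntegrable
  rw [norm_smul]
  exact mul_le_of_le_one_left (norm_nonneg _) (hc1 _)

lemma continuous_mode {c : ℝ → ℝ} (hc : Continuous c) (hc1 : ∀ s, |c s| ≤ 1) (hγ : Continuous γ)
    (hv : Integrable v) : Continuous (mode c γ v) := by
  refine intervalIntegral.continuous_of_dominated_interval (bound := fun η => ‖v η‖)
    (fun k => (intervalIntegrable_mode hc hγ hv k).def'.1)
    (fun k => Filter.Eventually.of_forall fun η _ => ?_) hv.norm.intervalIntegrable
    (Filter.Eventually.of_forall fun η _ => by fun_prop)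
  rw [norm_smul]
  exact mul_le_of_le_one_left (norm_nonneg _) (hc1 _)

/-- The vector amplitude at `x` of the mode of frequency `k` of the induced field. -/
def amplitude (γ v : ℝ → E3) (k x : E3) : E3 :=
  Real.cos (inner ℝ k x) • mode Real.sin γ v k - Real.sin (inner ℝ k x) • mode Real.cos γ v k

/-- The energy density of the frequency `k`. -/
def modeEnergy (γ v : ℝ → E3) (k : E3) : ℝ :=
  ‖mode Real.cos γ v k‖ ^ 2 + ‖mode Real.sin γ v k‖ ^ 2

lemma modeEnergy_nonneg (k : E3) : 0 ≤ modeEnergy γ v k := by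
  unfold modeEnergy
  positivity

lemma continuous_modeEnergy (hγ : Continuous γ) (hv : Integrable v) :
    Continuous (modeEnergy γ v) :=
  ((continuous_mode Real.continuous_cos Real.abs_cos_le_one hγ hv).norm.pow 2).add
    ((continuous_mode Real.continuous_sin Real.abs_sin_le_one hγ hv).norm.pow 2)

lemma modeEnergy_le (hv : Integrable v) (k : E3) :
    modeEnergy γ v k ≤ 2 * (∫ η in (0:ℝ)..1, ‖v η‖) ^ 2 := by
  have h₁ := pow_le_pow_left₀ (norm_nonneg _)
    (norm_mode_le (γ := γ) Real.abs_cos_le_one hv k) 2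
  have h₂ := pow_le_pow_left₀ (norm_nonneg _)
    (norm_mode_le (γ := γ) Real.abs_sin_le_one hv k) 2
  unfold modeEnergy
  linarith

lemma integrable_modeEnergy (μ : Measure E3) [IsFiniteMeasure μ] (hγ : Continuous γ)
    (hv : Integrable v) : Integrable (modeEnergy γ v) μ := by
  refine Integrable.mono' (integrable_const (2 * (∫ η in (0:ℝ)..1, ‖v η‖) ^ 2))
    (continuous_modeEnergy hγ hv).aestronglyMeasurable (Filter.Eventually.of_forall fun k => ?_)
  rw [Real.norm_of_nonneg (modeEnergy_nonneg k)]
  exact modeEnergy_le hv k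

lemma continuous_amplitude (hγ : Continuous γ) (hv : Integrable v) {X : Type*}
    [TopologicalSpace X] {f h : X → E3} (hf : Continuous f) (hh : Continuous h) :
    Continuous fun p => amplitude γ v (f p) (h p) := by
  have h₁ := continuous_mode Real.continuous_cos Real.abs_cos_le_one hγ hv
  have h₂ := continuous_mode Real.continuous_sin Real.abs_sin_le_one hγ hv
  unfold amplitude
  fun_prop

lemma norm_amplitude_sq_le (k x : E3) : ‖amplitude γ v k x‖ ^ 2 ≤ modeEnergy γ v k := by
  unfold amplitude modeEnergy
  set S := mode Real.sin γ v k
  set C := mode Real.cos γ v k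
  set a := (inner ℝ k x : ℝ)
  have h : ‖Real.cos a • S - Real.sin a • C‖ ≤ |Real.cos a| * ‖S‖ + |Real.sin a| * ‖C‖ := by
    simpa [norm_smul] using norm_sub_le (Real.cos a • S) (Real.sin a • C)
  have h' := pow_le_pow_left₀ (norm_nonneg _) h 2
  have e : |Real.cos a| ^ 2 + |Real.sin a| ^ 2 = 1 := by
    rw [sq_abs, sq_abs]
    exact Real.cos_sq_add_sin_sq a
  nlinarith [sq_nonneg (|Real.cos a| * ‖C‖ - |Real.sin a| * ‖S‖)]

lemma norm_crossL_amplitude_le (k x : E3) :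
    ‖crossL k (amplitude γ v k x)‖ ≤ ‖k‖ ^ 2 + modeEnergy γ v k := by
  have h := norm_amplitude_sq_le (γ := γ) (v := v) k x
  have h' : ‖crossL k (amplitude γ v k x)‖ ≤ ‖k‖ * ‖amplitude γ v k x‖ := norm_cross3_le _ _
  nlinarith [sq_nonneg (‖k‖ - ‖amplitude γ v k x‖), sq_nonneg ‖k‖,
    modeEnergy_nonneg (γ := γ) (v := v) k]

lemma norm_crossL_amplitude_sub_le (k x y : E3) :
    ‖crossL k (amplitude γ v k x) - crossL k (amplitude γ v k y)‖ ≤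
      (‖k‖ ^ 4 + modeEnergy γ v k) * ‖x - y‖ := by
  set S := mode Real.sin γ v k with hS
  set C := mode Real.cos γ v k with hC
  have hi : |(inner ℝ k x : ℝ) - inner ℝ k y| ≤ ‖k‖ * ‖x - y‖ := by
    rw [← inner_sub_right]
    exact abs_real_inner_le_norm _ _
  have h₁ : ‖amplitude γ v k x - amplitude γ v k y‖ ≤
      ‖k‖ * ‖x - y‖ * ‖S‖ + ‖k‖ * ‖x - y‖ * ‖C‖ := by
    have e : amplitude γ v k x - amplitude γ v k y =
        (Real.cos (inner ℝ k x) - Real.cos (inner ℝ k y)) • S -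
          (Real.sin (inner ℝ k x) - Real.sin (inner ℝ k y)) • C := by
      unfold amplitude
      module
    rw [e]
    refine (norm_sub_le _ _).trans ?_
    rw [norm_smul, norm_smul, Real.norm_eq_abs, Real.norm_eq_abs]
    gcongr
    · exact (IsCosineTransform.abs_cos_sub_cos_le _ _).trans hi
    · exact (IsCosineTransform.abs_sin_sub_sin_le _ _).trans hi
  have h₂ : ‖crossL k (amplitude γ v k x - amplitude γ v k y)‖ ≤
      ‖k‖ * ‖amplitude γ v k x - amplitude γ v k y‖ := norm_cross3_le _ _
  rw [← map_sub]
  have hE : modeEnergy γ v k = ‖C‖ ^ 2 + ‖S‖ ^ 2 := rfl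
  rw [hE]
  calc _ ≤ ‖k‖ * (‖k‖ * ‖x - y‖ * ‖S‖ + ‖k‖ * ‖x - y‖ * ‖C‖) := h₂.trans (by gcongr)
    _ = (‖k‖ ^ 2 * ‖S‖ + ‖k‖ ^ 2 * ‖C‖) * ‖x - y‖ := by ring
    _ ≤ _ := by
      refine mul_le_mul_of_nonneg_right ?_ (norm_nonneg _)
      nlinarith [sq_nonneg (‖k‖ ^ 2 - ‖S‖), sq_nonneg (‖k‖ ^ 2 - ‖C‖), sq_nonneg ‖S‖, sq_nonneg ‖C‖]

/-- Integration against a measure and along a curve can be exchanged. -/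
lemma integral_intervalIntegral_clm_swap {Z : Type*} [NormedAddCommGroup Z] [NormedSpace ℝ Z]
    {μ : Measure E3} [IsFiniteMeasure μ] {L : E3 → ℝ → E3 →L[ℝ] Z}
    (hL : Continuous fun p : E3 × ℝ => L p.1 p.2) {b : E3 → ℝ} (hb : Integrable b μ)
    (hLb : ∀ k η, ‖L k η‖ ≤ b k) (hv : Integrable v) :
    ∫ k, (∫ η in (0:ℝ)..1, L k η (v η)) ∂μ = ∫ η in (0:ℝ)..1, ∫ k, L k η (v η) ∂μ := by
  simp only [intervalIntegral.integral_of_le zero_le_one]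
  refine integral_integral_swap (f := fun k η => L k η (v η)) ?_
  have hv' : Integrable v (volume.restrict (Ioc 0 1)) := hv.restrict
  refine Integrable.mono' (hb.mul_prod hv'.norm) ?_ (Filter.Eventually.of_forall fun p => ?_)
  · exact (ContinuousLinearMap.apply ℝ Z : E3 →L[ℝ] (E3 →L[ℝ] Z) →L[ℝ] Z).aestronglyMeasurable_comp₂
      hv'.1.comp_snd hL.aestronglyMeasurable
  · exact (ContinuousLinearMap.le_opNorm _ _).trans (by gcongr; exact hLb _ _)

namespace IsCosineTransform

variable {φ : E3 → ℝ} {μ : Measure E3}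

/-- The induced velocity as a superposition of modes. -/
lemma inducedField_eq (hφ : IsCosineTransform φ μ) (hγ : Continuous γ) (hv : Integrable v)
    (x : E3) : inducedField (fun x => crossL (gradient φ x)) γ v x =
      ∫ k, crossL k (amplitude γ v k x) ∂μ := by
  have := hφ.finite
  have e₁ : ∀ η, crossL (gradient φ (x - γ η)) (v η) =
      ∫ k, (-Real.sin (inner ℝ k (x - γ η)) • crossL k) (v η) ∂μ := fun η => by
    rw [hφ.gradient_eq, grad]
    have h := (crossL.flip (v η)).integral_comp_comm (hφ.integrable_grad (x - γ η))
    simp only [map_smul, ContinuousLinearMap.flip_apply] at h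
    exact h.symm
  simp only [inducedField, e₁]
  rw [← integral_intervalIntegral_clm_swap (b := fun k => ‖k‖) (by fun_prop)
    (by simpa using hφ.integrable_norm_pow (n := 1) (by norm_num)) (fun k η => ?_) hv]
  · refine integral_congr_ae (Filter.Eventually.of_forall fun k => ?_)
    have i₁ : IntervalIntegrable (fun η => Real.sin (inner ℝ k x) •
        Real.cos (inner ℝ k (γ η)) • v η) volume 0 1 :=
      (intervalIntegrable_mode Real.continuous_cos hγ hv k).smul (Real.sin (inner ℝ k x))
    have i₂ : IntervalIntegrable (fun η => Real.cos (inner ℝ k x) •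
        Real.sin (inner ℝ k (γ η)) • v η) volume 0 1 :=
      (intervalIntegrable_mode Real.continuous_sin hγ hv k).smul (Real.cos (inner ℝ k x))
    have e₂ : ∀ η, (-Real.sin (inner ℝ k (x - γ η)) • crossL k) (v η) =
        crossL k (Real.cos (inner ℝ k x) • Real.sin (inner ℝ k (γ η)) • v η -
          Real.sin (inner ℝ k x) • Real.cos (inner ℝ k (γ η)) • v η) := fun η => by
      rw [inner_sub_right, Real.sin_sub, smul_apply, ← map_smul]
      congr 1
      module
    simp only [e₂]
    rw [ContinuousLinearMap.intervalIntegral_comp_comm _ (i₂.sub i₁),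
      intervalIntegral.integral_sub i₂ i₁, intervalIntegral.integral_smul,
      intervalIntegral.integral_smul]
    rfl
  · rw [norm_smul, norm_neg]
    exact (mul_le_of_le_one_left (norm_nonneg _) (Real.abs_sin_le_one _)).trans (norm_crossL_le k)

lemma integrable_crossL_amplitude (hφ : IsCosineTransform φ μ) (hγ : Continuous γ)
    (hv : Integrable v) (x : E3) : Integrable (fun k => crossL k (amplitude γ v k x)) μ := by
  have := hφ.finite
  refine Integrable.mono' ((hφ.integrable_norm_pow (n := 2) (by norm_num)).add
    (integrable_modeEnergy μ hγ hv)) ?_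
    (Filter.Eventually.of_forall fun k => norm_crossL_amplitude_le k x)
  exact (crossL.continuous.clm_apply
    (continuous_amplitude hγ hv continuous_id continuous_const)).aestronglyMeasurable

lemma norm_inducedField_le_modeEnergy (hφ : IsCosineTransform φ μ) (hγ : Continuous γ)
    (hv : Integrable v) (x : E3) : ‖inducedField (fun x => crossL (gradient φ x)) γ v x‖ ≤
      (∫ k, ‖k‖ ^ 2 ∂μ) + ∫ k, modeEnergy γ v k ∂μ := by
  have := hφ.finite
  have i₁ := hφ.integrable_norm_pow (n := 2) (by norm_num)
  have i₂ := integrable_modeEnergy μ hγ hv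
  rw [hφ.inducedField_eq hγ hv, ← integral_add i₁ i₂]
  exact norm_integral_le_of_norm_le (i₁.add i₂)
    (Filter.Eventually.of_forall fun k => norm_crossL_amplitude_le k x)

lemma norm_inducedField_sub_le_modeEnergy (hφ : IsCosineTransform φ μ) (hγ : Continuous γ)
    (hv : Integrable v) (x y : E3) : ‖inducedField (fun x => crossL (gradient φ x)) γ v x -
      inducedField (fun x => crossL (gradient φ x)) γ v y‖ ≤
      ((∫ k, ‖k‖ ^ 4 ∂μ) + ∫ k, modeEnergy γ v k ∂μ) * ‖x - y‖ := by
  have := hφ.finite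
  have i₁ := hφ.integrable_norm_pow (n := 4) (by norm_num)
  have i₂ := integrable_modeEnergy μ hγ hv
  rw [hφ.inducedField_eq hγ hv, hφ.inducedField_eq hγ hv,
    ← integral_sub (hφ.integrable_crossL_amplitude hγ hv x)
      (hφ.integrable_crossL_amplitude hγ hv y), ← integral_add i₁ i₂, ← integral_mul_const]
  exact norm_integral_le_of_norm_le ((i₁.add i₂).mul_const _)
    (Filter.Eventually.of_forall fun k => norm_crossL_amplitude_sub_le k x y)

/-- The work of the induced velocity along the curve vanishes. -/
lemma integral_inner_amplitude_eq_zero (hφ : IsCosineTransform φ μ) (hγ : Continuous γ)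
    (hv : Integrable v) {u : ℝ → E3} (hu : Continuous u) {b : ℝ} (hb : ∀ η, ‖u η‖ ≤ b)
    (hγu : ∀ η, inducedField (fun x => crossL (gradient φ x)) γ v (γ η) = u η) :
    ∫ k, (∫ η in (0:ℝ)..1, inner ℝ (amplitude γ v k (γ η)) (crossL k (crossL (v η) (u η)))) ∂μ
      = 0 := by
  have := hφ.finite
  have hM : Continuous fun p : E3 × ℝ => amplitude γ v p.1 (γ p.2) :=
    continuous_amplitude hγ hv continuous_fst (hγ.comp continuous_snd)
  have e : ∀ k η, (inner ℝ (amplitude γ v k (γ η)) (crossL k (crossL (v η) (u η))) : ℝ) =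
      ((innerSL ℝ (crossL k (amplitude γ v k (γ η)))).comp (-crossL.flip (u η))) (v η) :=
    fun k η => by
      rw [ContinuousLinearMap.comp_apply, innerSL_apply_apply, neg_apply,
        ContinuousLinearMap.flip_apply]
      simp only [crossL_apply]
      exact inner_cross3_eq_inner_neg _ _ _
  simp only [e]
  rw [integral_intervalIntegral_clm_swap
    (b := fun k => (‖k‖ ^ 2 + modeEnergy γ v k) * b) ?_
    (((hφ.integrable_norm_pow (n := 2) (by norm_num)).add (integrable_modeEnergy μ hγ hv)).mul_const
      b) (fun k η => ?_) hv]
  · refine (intervalIntegral.integral_congr fun η _ => ?_).trans intervalIntegral.integral_zero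
    simp only [ContinuousLinearMap.comp_apply, innerSL_apply_apply]
    have h := integral_inner (𝕜 := ℝ) (hφ.integrable_crossL_amplitude hγ hv (γ η))
      ((-crossL.flip (u η)) (v η))
    simp_rw [real_inner_comm ((-crossL.flip (u η)) (v η))]
    rw [h, ← hφ.inducedField_eq hγ hv, hγu]
    simp only [neg_apply, ContinuousLinearMap.flip_apply, crossL_apply, inner_neg_left,
      real_inner_comm, inner_cross3_right_self, neg_zero]
  · have : Continuous fun p : E3 × ℝ => crossL p.1 (amplitude γ v p.1 (γ p.2)) :=
      (crossL.continuous.comp continuous_fst).clm_apply hM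
    exact ((innerSL ℝ).continuous.comp this).clm_comp
      (crossL.flip.continuous.comp (hu.comp continuous_snd)).neg
  · refine (ContinuousLinearMap.opNorm_comp_le _ _).trans ?_
    rw [norm_neg, innerSL_apply_norm]
    gcongr
    · exact add_nonneg (by positivity) (modeEnergy_nonneg k)
    · exact norm_crossL_amplitude_le k _
    · refine (ContinuousLinearMap.opNorm_le_bound _ (norm_nonneg (u η)) fun z => ?_).trans (hb η)
      exact (norm_cross3_le _ _).trans (mul_comm _ _).le

end IsCosineTransform

end Mode

lemma integrable_crossL_apply {v u : ℝ → E3} (hv : Integrable v) (hu : Continuous u) {b : ℝ}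
    (hb : ∀ η, ‖u η‖ ≤ b) : Integrable fun η => crossL (v η) (u η) := by
  refine Integrable.mono' (hv.norm.mul_const b)
    (crossL.aestronglyMeasurable_comp₂ hv.1 hu.aestronglyMeasurable)
    (Filter.Eventually.of_forall fun η => ?_)
  exact (norm_cross3_le _ _).trans (by gcongr; exact hb η)

/-- The pairing of the modes of two densities along a curve, as an integral along the curve. -/
lemma inner_mode_crossL_mode {γ v z : ℝ → E3} (hγ : Continuous γ) (hz : Integrable z) (k : E3) :
    inner ℝ (mode Real.cos γ v k) (crossL k (mode (fun s => -Real.sin s) γ z k)) +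
        inner ℝ (mode Real.sin γ v k) (crossL k (mode Real.cos γ z k)) =
      ∫ η in (0:ℝ)..1, (inner ℝ (amplitude γ v k (γ η)) (crossL k (z η)) : ℝ) := by
  have i₁ := intervalIntegrable_mode (c := fun s => -Real.sin s) (by fun_prop) hγ hz k
  have i₂ := intervalIntegrable_mode Real.continuous_cos hγ hz k
  have j : ∀ (w : E3) {f : ℝ → E3}, IntervalIntegrable f volume 0 1 →
      IntervalIntegrable (fun η => (inner ℝ w (crossL k (f η)) : ℝ)) volume 0 1 ∧
      inner ℝ w (crossL k (∫ η in (0:ℝ)..1, f η)) =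
        ∫ η in (0:ℝ)..1, (inner ℝ w (crossL k (f η)) : ℝ) := fun w f hf =>
    ⟨⟨((innerSL ℝ w).comp (crossL k)).integrable_comp hf.1,
      ((innerSL ℝ w).comp (crossL k)).integrable_comp hf.2⟩,
      (ContinuousLinearMap.intervalIntegral_comp_comm ((innerSL ℝ w).comp (crossL k)) hf).symm⟩
  refine (congrArg₂ (· + ·) (j _ i₁).2 (j _ i₂).2).trans ?_
  rw [← intervalIntegral.integral_add (j _ i₁).1 (j _ i₂).1]
  refine intervalIntegral.integral_congr fun η _ => ?_
  simp only [amplitude, inner_sub_left, map_smul, inner_smul_left, inner_smul_right]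
  simp
  ring

namespace FilamentState

variable {g : ℝ → E3}

/-- The derivative of a mode in the direction of the state `z`. -/
def modeDeriv (c c' : ℝ → ℝ) (hg : Integrable g) (y z : FilamentState) (k : E3) : E3 :=
  ∫ η in (0:ℝ)..1, (c' (inner ℝ k (curve hg η y)) * inner ℝ k (curve hg η z)) • tangent g y η +
    c (inner ℝ k (curve hg η y)) • tangent g z η

section Mode

variable {c c' : ℝ → ℝ} {R : ℝ} {y z : FilamentState}

lemma norm_modeDeriv_integrand_le (hc : ∀ s, |c s| ≤ 1) (hc' : ∀ s, |c' s| ≤ 1)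
    (hg : Integrable g) (hy : ‖y‖ ≤ R) (hz : ‖z‖ ≤ R) (k : E3) (η : ℝ) :
    ‖(c' (inner ℝ k (curve hg η y)) * inner ℝ k (curve hg η z)) • tangent g y η +
      c (inner ℝ k (curve hg η y)) • tangent g z η‖ ≤
      (‖k‖ * ((1 + ∫ s, ‖g s‖) * R) * R + R) * ‖g η‖ := by
  have hG : 0 ≤ ∫ s, ‖g s‖ := integral_nonneg fun _ => norm_nonneg _
  have hR : 0 ≤ R := (norm_nonneg y).trans hy
  have h₁ : ‖tangent g y η‖ ≤ R * ‖g η‖ := (norm_tangent_le y η).trans (by gcongr)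
  have h₂ : ‖tangent g z η‖ ≤ R * ‖g η‖ := (norm_tangent_le z η).trans (by gcongr)
  have h₃ : |c' (inner ℝ k (curve hg η y)) * inner ℝ k (curve hg η z)| ≤
      ‖k‖ * ((1 + ∫ s, ‖g s‖) * R) := by
    rw [abs_mul]
    refine (mul_le_of_le_one_left (abs_nonneg _) (hc' _)).trans
      ((abs_real_inner_le_norm _ _).trans ?_)
    gcongr
    exact (norm_curve_le hg η z).trans (by gcongr)
  refine (norm_add_le _ _).trans ?_
  rw [norm_smul, norm_smul, add_mul, mul_assoc _ R]
  refine add_le_add ?_ ((mul_le_of_le_one_left (norm_nonneg _) (hc _)).trans h₂)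
  exact mul_le_mul h₃ h₁ (norm_nonneg _) (by positivity)

lemma norm_modeDeriv_le (hc : ∀ s, |c s| ≤ 1) (hc' : ∀ s, |c' s| ≤ 1)
    (hg : Integrable g) (hy : ‖y‖ ≤ R) (hz : ‖z‖ ≤ R) (k : E3) :
    ‖modeDeriv c c' hg y z k‖ ≤
      (‖k‖ * ((1 + ∫ s, ‖g s‖) * R) * R + R) * ∫ η in (0:ℝ)..1, ‖g η‖ := by
  rw [← intervalIntegral.integral_const_mul]
  exact intervalIntegral.norm_integral_le_of_norm_le zero_le_one
    (Filter.Eventually.of_forall fun η _ => norm_modeDeriv_integrand_le hc hc' hg hy hz k η)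
    (hg.norm.intervalIntegrable.const_mul _)

lemma hasDerivAt_mode (hd : ∀ s, HasDerivAt c (c' s) s) (hcc : Continuous c')
    (hc : ∀ s, |c s| ≤ 1) (hc' : ∀ s, |c' s| ≤ 1) (hg : Integrable g) {α α' : ℝ → FilamentState}
    {U : Set ℝ} (hU : IsOpen U) (hα : ∀ s ∈ U, HasDerivAt α (α' s) s) (hR : ∀ s ∈ U, ‖α s‖ ≤ R)
    (hR' : ∀ s ∈ U, ‖α' s‖ ≤ R) {t : ℝ} (ht : t ∈ U) (k : E3) :
    HasDerivAt (fun s => mode c (fun η => curve hg η (α s)) (tangent g (α s)) k)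
      (modeDeriv c c' hg (α t) (α' t) k) t := by
  have hcont : Continuous c := continuous_iff_continuousAt.2 fun s => (hd s).continuousAt
  refine (intervalIntegral.hasDerivAt_integral_of_dominated_loc_of_deriv_le (s := U)
    (F := fun s η => c (inner ℝ k (curve hg η (α s))) • tangent g (α s) η)
    (F' := fun s η => (c' (inner ℝ k (curve hg η (α s))) * inner ℝ k (curve hg η (α' s))) •
      tangent g (α s) η + c (inner ℝ k (curve hg η (α s))) • tangent g (α' s) η)
    (bound := fun η => (‖k‖ * ((1 + ∫ s, ‖g s‖) * R) * R + R) * ‖g η‖)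
    (hU.mem_nhds ht) (Filter.Eventually.of_forall fun s => ?_) ?_ ?_
    (Filter.Eventually.of_forall fun η _ s hs =>
      norm_modeDeriv_integrand_le hc hc' hg (hR s hs) (hR' s hs) k η)
    (hg.norm.intervalIntegrable.const_mul _)
    (Filter.Eventually.of_forall fun η _ s hs => ?_)).2
  · exact (intervalIntegrable_mode hcont (continuous_curve hg _) (integrable_tangent hg _)
      k).def'.1
  · exact intervalIntegrable_mode hcont (continuous_curve hg _) (integrable_tangent hg _) k
  · have h₁ := continuous_curve hg (α t)
    have h₂ := continuous_curve hg (α' t)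
    exact ((by fun_prop : Continuous fun η => c' (inner ℝ k (curve hg η (α t))) *
      inner ℝ k (curve hg η (α' t))).aestronglyMeasurable.smul
        (integrable_tangent hg _).1.restrict).add
      ((by fun_prop : Continuous fun η =>
        c (inner ℝ k (curve hg η (α t)))).aestronglyMeasurable.smul
        (integrable_tangent hg _).1.restrict)
  · have e₁ : HasDerivAt (fun s => curve hg η (α s)) (curve hg η (α' s)) s :=
      (curve hg η).hasFDerivAt.comp_hasDerivAt s (hα s hs)
    have e₂ : HasDerivAt (fun s => tangent g (α s) η) (tangent g (α' s) η) s :=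
      (tangentL g η).hasFDerivAt.comp_hasDerivAt s (hα s hs)
    have e₃ : HasDerivAt (fun s => (inner ℝ k (curve hg η (α s)) : ℝ))
        (inner ℝ k (curve hg η (α' s))) s :=
      (innerSL ℝ k).hasFDerivAt.comp_hasDerivAt s e₁
    have := ((hd _).comp s e₃).smul e₂
    rw [add_comm]
    exact this

end Mode

variable {K : E3 → E3 →L[ℝ] E3} {K' : E3 → E3 →L[ℝ] E3 →L[ℝ] E3} {B : ℝ}

/-- The density transported by the flow: the cross product of the tangent and the velocity. -/
def lambVector (K : E3 → E3 →L[ℝ] E3) (hg : Integrable g) (y : FilamentState) (η : ℝ) : E3 :=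
  crossL (tangent g y η) (stateField K hg y (curve hg η y))

lemma continuous_stateField_curve (hK : IsSmoothKernel K K' B) (hg : Integrable g)
    (y : FilamentState) : Continuous fun η => stateField K hg y (curve hg η y) :=
  (continuous_stateField hK.norm_le hK.norm_sub_le hK.continuous hg y).comp (continuous_curve hg y)

lemma integrable_lambVector (hK : IsSmoothKernel K K' B) (hg : Integrable g) (y : FilamentState) :
    Integrable (lambVector K hg y) :=
  integrable_crossL_apply (integrable_tangent hg y) (continuous_stateField_curve hK hg y)
    fun _ => norm_stateField_le hK.nonneg hK.norm_le hg y _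

/-- The evolution of the modes of a closed curve. -/
lemma modeDeriv_smul_vectorField {c c' : ℝ → ℝ} (hd : ∀ s, HasDerivAt c (c' s) s)
    (hcc : Continuous c') (hK : IsSmoothKernel K K' B) (hg : Integrable g) {y : FilamentState}
    (hy : curve hg 0 y = curve hg 1 y) (θ : ℝ) (k : E3) :
    modeDeriv c c' hg y (θ • vectorField hK hg y) k =
      θ • crossL k (mode c' (fun η => curve hg η y) (lambVector K hg y) k) := by
  have hcont : Continuous c := continuous_iff_continuousAt.2 fun s => (hd s).continuousAt
  set u := stateField K hg y with hu
  set Du := stateField (derivKernel K') hg y with hDu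
  have hu_cont : Continuous u :=
    continuous_stateField hK.norm_le hK.norm_sub_le hK.continuous hg y
  have hDu_cont : Continuous Du := continuous_stateField hK.norm_derivKernel_le
    hK.norm_derivKernel_sub_le hK.continuous_derivKernel hg y
  set F' : E3 → E3 →L[ℝ] E3 := fun x =>
    c (inner ℝ k x) • Du x + (c' (inner ℝ k x) • innerSL ℝ k).smulRight (u x) with hF'
  have hF : ∀ x, HasFDerivAt (fun x => c (inner ℝ k x) • u x) (F' x) x := fun x =>
    ((hd _).comp_hasFDerivAt x (innerSL ℝ k).hasFDerivAt).smul (hasFDerivAt_stateField hK hg y x)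
  have hF'c : Continuous F' := by
    have : F' = fun x => c (inner ℝ k x) • Du x +
        c' (inner ℝ k x) • ContinuousLinearMap.smulRightL ℝ E3 E3 (innerSL ℝ k) (u x) := by
      ext x z
      simp [hF', smul_smul, mul_assoc]
    rw [this]
    fun_prop
  have hw : IntervalIntegrable (tangent g y) volume 0 1 :=
    (integrable_tangent hg y).intervalIntegrable
  have h0 : ∫ s in (0:ℝ)..1, F' (curve hg s y) (tangent g y s) = 0 := by
    have h := comp_eq_add_integral_of_eq_add_integral hF hF'c hw
      (γ := fun ξ => curve hg ξ y) (fun ξ _ => curve_eq_add_integral hg ξ y)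
      (right_mem_Icc.2 zero_le_one)
    rw [← hy] at h
    simpa using h
  have i₁ : IntervalIntegrable (fun s => F' (curve hg s y) (tangent g y s)) volume 0 1 :=
    (hF'c.comp (continuous_curve hg y)).continuousOn.intervalIntegrable_clm_apply hw
  have i₂ := intervalIntegrable_mode hcc (continuous_curve hg y) (integrable_lambVector hK hg y) k
  have i₃ : IntervalIntegrable (fun η => crossL k (c' (inner ℝ k (curve hg η y)) •
      lambVector K hg y η)) volume 0 1 :=
    ⟨(crossL k).integrable_comp i₂.1, (crossL k).integrable_comp i₂.2⟩
  have e : ∀ η ∈ uIcc (0:ℝ) 1,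
      (c' (inner ℝ k (curve hg η y)) * inner ℝ k (curve hg η (θ • vectorField hK hg y))) •
        tangent g y η + c (inner ℝ k (curve hg η y)) • tangent g (θ • vectorField hK hg y) η =
      θ • (F' (curve hg η y) (tangent g y η) +
        crossL k (c' (inner ℝ k (curve hg η y)) • lambVector K hg y η)) := by
    intro η hη
    rw [uIcc_of_le zero_le_one] at hη
    have e₁ : tangent g (θ • vectorField hK hg y) η = θ • Du (curve hg η y) (tangent g y η) := rfl
    rw [map_smul, curve_vectorField hK hg y hη, e₁, map_smul, lambVector, crossL_apply,
      crossL_apply, cross3_cross3]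
    simp only [hF', ← hu, add_apply, smul_apply, ContinuousLinearMap.smulRight_apply,
      innerSL_apply_apply, inner_smul_right, smul_eq_mul]
    module
  rw [modeDeriv, intervalIntegral.integral_congr e, intervalIntegral.integral_smul,
    intervalIntegral.integral_add i₁ i₃, h0, zero_add,
    ContinuousLinearMap.intervalIntegral_comp_comm _ i₂]
  rfl

end FilamentState

namespace FilamentState

variable {g : ℝ → E3} {K : E3 → E3 →L[ℝ] E3} {K' : E3 → E3 →L[ℝ] E3 →L[ℝ] E3} {B : ℝ}

lemma norm_vectorField_le (hK : IsSmoothKernel K K' B) (hg : Integrable g) {y : FilamentState}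
    {R : ℝ} (hy : ‖y‖ ≤ R) :
    ‖vectorField hK hg y‖ ≤ B * ((∫ s, ‖g s‖) * R) * (1 + R) := by
  have hG : 0 ≤ ∫ s, ‖g s‖ := integral_nonneg fun _ => norm_nonneg _
  have hB := hK.nonneg
  have hR : 0 ≤ R := (norm_nonneg y).trans hy
  refine norm_le_of_forall ?_ fun ξ => ?_
  · calc _ ≤ B * ((∫ s, ‖g s‖) * ‖y‖) := norm_stateField_le hB hK.norm_le hg y _
      _ ≤ B * ((∫ s, ‖g s‖) * R) * 1 := by rw [mul_one]; gcongr
      _ ≤ _ := by gcongr; linarith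
  · calc _ ≤ B * ((∫ s, ‖g s‖) * ‖y‖) * ‖y‖ := norm_transport_le hK hg y ξ
      _ ≤ B * ((∫ s, ‖g s‖) * R) * R := by gcongr
      _ ≤ _ := by gcongr; linarith

/-- Closed curves remain closed along the flow. -/
lemma curve_zero_eq_curve_one (hK : IsSmoothKernel K K' B) (hg : Integrable g)
    {α : ℝ → FilamentState} {θ : ℝ → ℝ} (hθ : ∀ t, 0 ≤ θ t ∧ θ t ≤ 1) {b : ℝ}
    (hc : ContinuousOn α (Icc 0 b))
    (hα : ∀ t ∈ Ico 0 b, HasDerivWithinAt α (θ t • vectorField hK hg (α t)) (Ici t) t)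
    (h0 : curve hg 0 (α 0) = curve hg 1 (α 0)) {t : ℝ} (ht : t ∈ Icc 0 b) :
    curve hg 0 (α t) = curve hg 1 (α t) := by
  have hB := hK.nonneg
  have hG : 0 ≤ ∫ s, ‖g s‖ := integral_nonneg fun _ => norm_nonneg _
  obtain ⟨R, hR⟩ := (isCompact_Icc.image_of_continuousOn hc).isBounded.exists_norm_le
  replace hR : ∀ s ∈ Icc 0 b, ‖α s‖ ≤ R := fun s hs => hR _ (mem_image_of_mem _ hs)
  refine sub_eq_zero.1 (eq_zero_of_abs_deriv_le_mul_abs_self_of_eq_zero_right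
    (f := fun t => curve hg 0 (α t) - curve hg 1 (α t)) (K := B * ((∫ s, ‖g s‖) * R))
    (f' := fun t => curve hg 0 (θ t • vectorField hK hg (α t)) -
      curve hg 1 (θ t • vectorField hK hg (α t)))
    (by fun_prop) (fun s hs => ?_) (sub_eq_zero.2 h0) (fun s hs => ?_) t ht)
  · exact ((curve hg 0).hasFDerivAt.comp_hasDerivWithinAt s (hα s hs)).sub
      ((curve hg 1).hasFDerivAt.comp_hasDerivWithinAt s (hα s hs))
  · rw [map_smul, map_smul, ← smul_sub, norm_smul, Real.norm_of_nonneg (hθ s).1,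
      curve_vectorField hK hg _ (left_mem_Icc.2 zero_le_one),
      curve_vectorField hK hg _ (right_mem_Icc.2 zero_le_one)]
    refine (mul_le_of_le_one_left (norm_nonneg _) (hθ s).2).trans ?_
    have h := norm_stateField_sub_le hK.norm_le hK.norm_sub_le hK.continuous hg (y₂ := α s)
      (hR s (Ico_subset_Icc_self hs)) (curve hg 0 (α s)) (curve hg 1 (α s))
    simp only [sub_self, norm_zero, mul_zero, add_zero] at h
    exact h.trans (le_of_eq (by ring))

/-- The spectral energy of the curve described by a state. -/
def stateEnergy (μ : Measure E3) (hg : Integrable g) (y : FilamentState) : ℝ :=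
  ∫ k, modeEnergy (fun η => curve hg η y) (tangent g y) k ∂μ

variable {φ : E3 → ℝ} {μ : Measure E3}

lemma hasDerivAt_stateEnergy (hφ : IsCosineTransform φ μ)
    (hK : IsSmoothKernel (fun x => crossL (gradient φ x)) K' B) (hg : Integrable g)
    {α : ℝ → FilamentState} {θ : ℝ → ℝ} (hθ : ∀ t, 0 ≤ θ t ∧ θ t ≤ 1) {U : Set ℝ} (hU : IsOpen U)
    (hα : ∀ t ∈ U, HasDerivAt α (θ t • vectorField hK hg (α t)) t) {t : ℝ} (ht : t ∈ U)
    (hcl : curve hg 0 (α t) = curve hg 1 (α t)) :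
    HasDerivAt (fun s => stateEnergy μ hg (α s)) 0 t := by
  have := hφ.finite
  have hG : 0 ≤ ∫ s, ‖g s‖ := integral_nonneg fun _ => norm_nonneg _
  set V := U ∩ α ⁻¹' Metric.ball 0 (‖α t‖ + 1) with hV
  have hcont : ContinuousOn α U := fun s hs => (hα s hs).continuousAt.continuousWithinAt
  have hVo : IsOpen V := hcont.isOpen_inter_preimage hU Metric.isOpen_ball
  have htV : t ∈ V := ⟨ht, by simp⟩
  set R := max (‖α t‖ + 1)
    (B * ((∫ s, ‖g s‖) * (‖α t‖ + 1)) * (1 + (‖α t‖ + 1))) with hR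
  have hb : ∀ s ∈ V, ‖α s‖ ≤ ‖α t‖ + 1 := fun s hs =>
    (mem_ball_zero_iff.1 hs.2).le
  have hb₁ : ∀ s ∈ V, ‖α s‖ ≤ R := fun s hs => (hb s hs).trans (le_max_left _ _)
  have hb₂ : ∀ s ∈ V, ‖θ s • vectorField hK hg (α s)‖ ≤ R := fun s hs => by
    rw [norm_smul, Real.norm_of_nonneg (hθ s).1]
    exact ((mul_le_of_le_one_left (norm_nonneg _) (hθ s).2).trans
      (norm_vectorField_le hK hg (hb s hs))).trans (le_max_right _ _)
  have hR0 : 0 ≤ R := (norm_nonneg _).trans (hb₁ t htV)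
  set q : ℝ → ℝ → E3 := fun s η => curve hg η (α s) with hq
  set w : ℝ → ℝ → E3 := fun s => tangent g (α s) with hw
  have hq_cont : ∀ s, Continuous (q s) := fun s => continuous_curve hg (α s)
  have hw_int : ∀ s, Integrable (w s) := fun s => integrable_tangent hg (α s)
  have hw_le : ∀ s ∈ V, ∫ η in (0:ℝ)..1, ‖w s η‖ ≤ (∫ s, ‖g s‖) * R := fun s hs =>
    (integral_norm_tangent_le hg (α s)).trans (by gcongr; exact hb₁ s hs)
  have hsin1 : ∀ s, |-Real.sin s| ≤ 1 := fun s => by rw [abs_neg]; exact Real.abs_sin_le_one s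
  set C' : ℝ → E3 → E3 := fun s =>
    modeDeriv Real.cos (fun s => -Real.sin s) hg (α s) (θ s • vectorField hK hg (α s)) with hC'
  set S' : ℝ → E3 → E3 := fun s =>
    modeDeriv Real.sin Real.cos hg (α s) (θ s • vectorField hK hg (α s)) with hS'
  set N : E3 → ℝ := fun k =>
    (‖k‖ * ((1 + ∫ s, ‖g s‖) * R) * R + R) * ∫ η in (0:ℝ)..1, ‖g η‖ with hN
  have hC'_le : ∀ s ∈ V, ∀ k, ‖C' s k‖ ≤ N k := fun s hs k =>
    norm_modeDeriv_le Real.abs_cos_le_one hsin1 hg (hb₁ s hs) (hb₂ s hs) k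
  have hS'_le : ∀ s ∈ V, ∀ k, ‖S' s k‖ ≤ N k := fun s hs k =>
    norm_modeDeriv_le Real.abs_sin_le_one Real.abs_cos_le_one hg (hb₁ s hs) (hb₂ s hs) k
  have hC'_eq : ∀ k, C' t k = θ t • crossL k (mode (fun s => -Real.sin s) (q t)
      (lambVector _ hg (α t)) k) := fun k =>
    modeDeriv_smul_vectorField Real.hasDerivAt_cos Real.continuous_sin.neg hK hg hcl _ k
  have hS'_eq : ∀ k, S' t k = θ t • crossL k (mode Real.cos (q t)
      (lambVector _ hg (α t)) k) := fun k =>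
    modeDeriv_smul_vectorField Real.hasDerivAt_sin Real.continuous_cos hK hg hcl _ k
  have hderiv := (hasDerivAt_integral_of_dominated_loc_of_deriv_le (μ := μ) (s := V) (x₀ := t)
    (F := fun s k => modeEnergy (q s) (w s) k)
    (F' := fun s k => 2 * inner ℝ (mode Real.cos (q s) (w s) k) (C' s k) +
      2 * inner ℝ (mode Real.sin (q s) (w s) k) (S' s k))
    (bound := fun k => 4 * ((∫ s, ‖g s‖) * R) * N k)
    (hVo.mem_nhds htV)
    (Filter.Eventually.of_forall fun s =>
      (continuous_modeEnergy (hq_cont s) (hw_int s)).aestronglyMeasurable)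
    (integrable_modeEnergy μ (hq_cont t) (hw_int t)) ?_
    (Filter.Eventually.of_forall fun k s hs => ?_) ?_
    (Filter.Eventually.of_forall fun k s hs => ?_)).2
  · refine hderiv.congr_deriv ?_
    have e : ∀ k, 2 * inner ℝ (mode Real.cos (q t) (w t) k) (C' t k) +
        2 * inner ℝ (mode Real.sin (q t) (w t) k) (S' t k) =
        2 * θ t * ∫ η in (0:ℝ)..1, (inner ℝ (amplitude (q t) (w t) k (q t η))
          (crossL k (lambVector (fun x => crossL (gradient φ x)) hg (α t) η)) : ℝ) := fun k => by
      rw [hC'_eq, hS'_eq, inner_smul_right, inner_smul_right,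
        ← inner_mode_crossL_mode (hq_cont t) (integrable_lambVector hK hg (α t)) k]
      ring
    simp only [e]
    rw [integral_const_mul]
    exact mul_eq_zero_of_right _ (hφ.integral_inner_amplitude_eq_zero (hq_cont t) (hw_int t)
      (continuous_stateField_curve hK hg (α t))
      (fun η => norm_stateField_le hK.nonneg hK.norm_le hg (α t) _) (fun η => rfl))
  · have h₁ := continuous_mode Real.continuous_cos Real.abs_cos_le_one (hq_cont t) (hw_int t)
    have h₂ := continuous_mode Real.continuous_sin Real.abs_sin_le_one (hq_cont t) (hw_int t)
    have h₃ := continuous_mode (c := fun s => -Real.sin s) (by fun_prop) hsin1 (hq_cont t)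
      (integrable_lambVector hK hg (α t))
    have h₄ := continuous_mode Real.continuous_cos Real.abs_cos_le_one (hq_cont t)
      (integrable_lambVector hK hg (α t))
    simp only [hC'_eq, hS'_eq]
    exact (by fun_prop : Continuous _).aestronglyMeasurable
  · have h₁ := norm_mode_le (γ := q s) Real.abs_cos_le_one (hw_int s) k
    have h₂ := norm_mode_le (γ := q s) Real.abs_sin_le_one (hw_int s) k
    have h₃ := (abs_real_inner_le_norm _ _).trans (mul_le_mul (h₁.trans (hw_le s hs))
      (hC'_le s hs k) (norm_nonneg _) (by positivity))
    have h₄ := (abs_real_inner_le_norm _ _).trans (mul_le_mul (h₂.trans (hw_le s hs))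
      (hS'_le s hs k) (norm_nonneg _) (by positivity))
    rw [abs_le] at h₃ h₄
    rw [Real.norm_eq_abs, abs_le]
    constructor <;> nlinarith [h₃.1, h₃.2, h₄.1, h₄.2]
  · have hk : Integrable (fun k : E3 => ‖k‖) μ := by
      simpa using hφ.integrable_norm_pow (n := 1) (by norm_num)
    exact ((((hk.mul_const _).mul_const _).add (integrable_const _)).mul_const _).const_mul _
  · have h₁ := (hasDerivAt_mode Real.hasDerivAt_cos Real.continuous_sin.neg Real.abs_cos_le_one
      hsin1 hg hVo (fun s hs => hα s hs.1) hb₁ hb₂ hs k).norm_sq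
    have h₂ := (hasDerivAt_mode Real.hasDerivAt_sin Real.continuous_cos Real.abs_sin_le_one
      Real.abs_cos_le_one hg hVo (fun s hs => hα s hs.1) hb₁ hb₂ hs k).norm_sq
    exact h₁.add h₂

lemma stateEnergy_eq (hφ : IsCosineTransform φ μ)
    (hK : IsSmoothKernel (fun x => crossL (gradient φ x)) K' B) (hg : Integrable g)
    {α : ℝ → FilamentState} {θ : ℝ → ℝ} (hθ : ∀ t, 0 ≤ θ t ∧ θ t ≤ 1) {T : ℝ}
    (hα : ∀ t ∈ Ioo (-T) T, HasDerivAt α (θ t • vectorField hK hg (α t)) t)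
    (hcl : curve hg 0 (α 0) = curve hg 1 (α 0)) {t : ℝ} (ht : t ∈ Ico 0 T) :
    stateEnergy μ hg (α t) = stateEnergy μ hg (α 0) := by
  have hsub : Icc 0 t ⊆ Ioo (-T) T := fun s hs =>
    ⟨by linarith [hs.1, ht.1, ht.2], hs.2.trans_lt ht.2⟩
  have hcl' : ∀ s ∈ Icc 0 t, curve hg 0 (α s) = curve hg 1 (α s) := fun s hs =>
    curve_zero_eq_curve_one hK hg hθ
      (fun r hr => (hα r (hsub hr)).continuousAt.continuousWithinAt)
      (fun r hr => (hα r (hsub (Ico_subset_Icc_self hr))).hasDerivWithinAt) hcl hs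
  have hd : ∀ s ∈ Icc 0 t, HasDerivAt (fun s => stateEnergy μ hg (α s)) 0 s := fun s hs =>
    hasDerivAt_stateEnergy hφ hK hg hθ isOpen_Ioo hα (hsub hs) (hcl' s hs)
  exact constant_of_has_deriv_right_zero
    (fun s hs => (hd s hs).continuousAt.continuousWithinAt)
    (fun s hs => (hd s (Ico_subset_Icc_self hs)).hasDerivWithinAt) t (right_mem_Icc.2 ht.1)

lemma norm_stateField_le_stateEnergy (hφ : IsCosineTransform φ μ) (hg : Integrable g)
    (y : FilamentState) (x : E3) : ‖stateField (fun x => crossL (gradient φ x)) hg y x‖ ≤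
      (∫ k, ‖k‖ ^ 2 ∂μ) + stateEnergy μ hg y :=
  hφ.norm_inducedField_le_modeEnergy (continuous_curve hg y) (integrable_tangent hg y) x

lemma norm_stateField_derivKernel_le_stateEnergy (hφ : IsCosineTransform φ μ)
    (hK : IsSmoothKernel (fun x => crossL (gradient φ x)) K' B) (hg : Integrable g)
    (y : FilamentState) (x : E3) : ‖stateField (derivKernel K') hg y x‖ ≤
      (∫ k, ‖k‖ ^ 4 ∂μ) + stateEnergy μ hg y := by
  refine (hasFDerivAt_stateField hK hg y x).le_of_lip' ?_ (Filter.Eventually.of_forall fun z =>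
    hφ.norm_inducedField_sub_le_modeEnergy (continuous_curve hg y) (integrable_tangent hg y) z x)
  exact add_nonneg (integral_nonneg fun _ => by positivity)
    (integral_nonneg fun _ => modeEnergy_nonneg _)

/-- The evaluation of the transport matrix as a continuous linear map. -/
def transportL (ξ : ℝ) : FilamentState →L[ℝ] E3 →L[ℝ] E3 :=
  LinearMap.mkContinuous
    { toFun := fun y => y.2 ξ
      map_add' := fun _ _ => rfl
      map_smul' := fun _ _ => rfl }
    1 fun y => (norm_snd_apply_le y ξ).trans (one_mul _).ge

/-- The conservation of the energy bounds the states reached in finite time. -/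
lemma norm_le_of_hasDerivAt (hφ : IsCosineTransform φ μ)
    (hK : IsSmoothKernel (fun x => crossL (gradient φ x)) K' B) (hg : Integrable g)
    {α : ℝ → FilamentState} {θ : ℝ → ℝ} (hθ : ∀ t, 0 ≤ θ t ∧ θ t ≤ 1) {T : ℝ}
    (hα : ∀ t ∈ Ioo (-T) T, HasDerivAt α (θ t • vectorField hK hg (α t)) t)
    (hcl : curve hg 0 (α 0) = curve hg 1 (α 0)) {t : ℝ} (ht : t ∈ Ico 0 T) :
    ‖α t‖ ≤ max (‖α 0‖ + ((∫ k, ‖k‖ ^ 2 ∂μ) + stateEnergy μ hg (α 0)) * T)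
      (‖α 0‖ * Real.exp (((∫ k, ‖k‖ ^ 4 ∂μ) + stateEnergy μ hg (α 0)) * T)) := by
  have hsub : Icc 0 t ⊆ Ioo (-T) T := fun s hs =>
    ⟨by linarith [hs.1, ht.1, ht.2], hs.2.trans_lt ht.2⟩
  have hE : ∀ s ∈ Icc 0 t, stateEnergy μ hg (α s) = stateEnergy μ hg (α 0) := fun s hs =>
    stateEnergy_eq hφ hK hg hθ hα hcl ⟨hs.1, hs.2.trans_lt ht.2⟩
  have hE0 : 0 ≤ stateEnergy μ hg (α 0) := integral_nonneg fun _ => modeEnergy_nonneg _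
  have hm : ∀ n : ℕ, 0 ≤ ∫ k : E3, ‖k‖ ^ n ∂μ := fun n => integral_nonneg fun _ => by positivity
  have hc : ContinuousOn α (Icc 0 t) := fun s hs =>
    (hα s (hsub hs)).continuousAt.continuousWithinAt
  have hd : ∀ s ∈ Ico 0 t, HasDerivWithinAt α (θ s • vectorField hK hg (α s)) (Ici s) s :=
    fun s hs => (hα s (hsub (Ico_subset_Icc_self hs))).hasDerivWithinAt
  refine norm_le_of_forall (le_max_of_le_left ?_) fun ξ => le_max_of_le_right ?_
  · have h := norm_image_sub_le_of_norm_deriv_right_le_segment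
      (f := fun s => curve hg 0 (α s)) (f' := fun s => curve hg 0 (θ s • vectorField hK hg (α s)))
      (C := (∫ k, ‖k‖ ^ 2 ∂μ) + stateEnergy μ hg (α 0)) (by fun_prop)
      (fun s hs => (curve hg 0).hasFDerivAt.comp_hasDerivWithinAt s (hd s hs))
      (fun s hs => ?_) t (right_mem_Icc.2 ht.1)
    · simp only [curve_zero] at h
      have h₁ := norm_fst_le (α 0)
      have h₂ := norm_le_norm_add_norm_sub' (α t).1 (α 0).1
      have h₃ := mul_le_mul_of_nonneg_left (a := (∫ k, ‖k‖ ^ 2 ∂μ) + stateEnergy μ hg (α 0))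
        (by linarith [ht.2] : t - 0 ≤ T) (add_nonneg (hm 2) hE0)
      linarith
    · rw [map_smul, norm_smul, Real.norm_of_nonneg (hθ s).1,
        curve_vectorField hK hg _ (left_mem_Icc.2 zero_le_one), ← hE s (Ico_subset_Icc_self hs)]
      exact (mul_le_of_le_one_left (norm_nonneg _) (hθ s).2).trans
        (norm_stateField_le_stateEnergy hφ hg _ _)
  · have h := norm_le_gronwallBound_of_norm_deriv_right_le
      (f := fun s => transportL ξ (α s))
      (f' := fun s => transportL ξ (θ s • vectorField hK hg (α s)))
      (δ := ‖α 0‖) (K := (∫ k, ‖k‖ ^ 4 ∂μ) + stateEnergy μ hg (α 0)) (ε := 0) (by fun_prop)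
      (fun s hs => (transportL ξ).hasFDerivAt.comp_hasDerivWithinAt s (hd s hs))
      (norm_snd_apply_le (α 0) ξ) (fun s hs => ?_) t (right_mem_Icc.2 ht.1)
    · rw [gronwallBound_ε0] at h
      refine h.trans ?_
      have hK0 := add_nonneg (hm 4) hE0
      gcongr
      linarith [ht.2]
    · rw [map_smul, norm_smul, Real.norm_of_nonneg (hθ s).1, ← hE s (Ico_subset_Icc_self hs),
        add_zero]
      refine (mul_le_of_le_one_left (norm_nonneg _) (hθ s).2).trans
        ((ContinuousLinearMap.opNorm_comp_le _ _).trans ?_)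
      exact mul_le_mul_of_nonneg_right
        (norm_stateField_derivKernel_le_stateEnergy hφ hK hg _ _) (norm_nonneg _)

/-- The Lagrangian formulation has global solutions issued from closed curves. -/
lemma exists_forward_integralCurve (hφ : IsCosineTransform φ μ)
    (hK : IsSmoothKernel (fun x => crossL (gradient φ x)) K' B) (hg : Integrable g)
    {y₀ : FilamentState} (hcl : curve hg 0 y₀ = curve hg 1 y₀) :
    ∃ α : ℝ → FilamentState, α 0 = y₀ ∧ ContinuousOn α (Ici 0) ∧
      ∀ t > 0, HasDerivAt α (vectorField hK hg (α t)) t := by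
  refine exists_forward_integralCurve_of_bound (exists_lipschitzOnWith_vectorField hK hg) y₀
    fun T _ => ⟨max (‖y₀‖ + ((∫ k, ‖k‖ ^ 2 ∂μ) + stateEnergy μ hg y₀) * T)
      (‖y₀‖ * Real.exp (((∫ k, ‖k‖ ^ 4 ∂μ) + stateEnergy μ hg y₀) * T)),
      fun θ hθ α h0 hα t ht => ?_⟩
  subst h0
  exact norm_le_of_hasDerivAt hφ hK hg hθ hα hcl ht

end FilamentState

namespace FilamentState

variable {g : ℝ → E3} {K : E3 → E3 →L[ℝ] E3} {K' : E3 → E3 →L[ℝ] E3 →L[ℝ] E3} {B : ℝ}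

lemma continuous_vectorField (hK : IsSmoothKernel K K' B) (hg : Integrable g) :
    Continuous (vectorField hK hg) := by
  refine continuous_iff_continuousAt.2 fun y => ?_
  obtain ⟨L, hL⟩ := exists_lipschitzOnWith_vectorField hK hg (‖y‖ + 1)
  refine hL.continuousOn.continuousAt (Filter.mem_of_superset
    (Metric.ball_mem_nhds y one_pos) fun z hz => ?_)
  rw [mem_closedBall_zero_iff]
  have h := norm_le_norm_add_norm_sub' z y
  rw [Metric.mem_ball, dist_eq_norm] at hz
  linarith

/-- A continuous forward integral curve is differentiable from the right at the initial time. -/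
lemma hasDerivWithinAt_Ici (hK : IsSmoothKernel K K' B) (hg : Integrable g)
    {α : ℝ → FilamentState} (hc : ContinuousOn α (Ici 0))
    (hα : ∀ t > 0, HasDerivAt α (vectorField hK hg (α t)) t) {t : ℝ} (ht : 0 ≤ t) :
    HasDerivWithinAt α (vectorField hK hg (α t)) (Ici 0) t := by
  rcases ht.eq_or_lt with rfl | ht
  · have h0 := hc 0 self_mem_Ici
    refine hasDerivWithinAt_Ici_of_tendsto_deriv (s := Ioi 0)
      (fun s hs => (hα s hs).differentiableAt.differentiableWithinAt)
      (h0.mono Ioi_subset_Ici_self) self_mem_nhdsWithin ?_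
    have h := ((continuous_vectorField hK hg).continuousAt.comp_continuousWithinAt
      (h0.mono Ioi_subset_Ici_self)).tendsto
    exact h.congr' (Filter.eventually_of_mem self_mem_nhdsWithin fun s hs => (hα s hs).deriv.symm)
  · exact (hα t ht).hasDerivWithinAt

/-- The curves described by a forward integral curve of the Lagrangian formulation solve the
filament equation. -/
lemma isGlobalFilamentSolution {φ : E3 → ℝ}
    (hK : IsSmoothKernel (fun x => crossL (gradient φ x)) K' B) (hg : Integrable g)
    (hg2 : MemLp g 2) {γ₀ : ℝ → E3} {α : ℝ → FilamentState}
    (hγ₀ : ∀ ξ ∈ Icc (0:ℝ) 1, curve hg ξ (α 0) = γ₀ ξ) (hcl : γ₀ 0 = γ₀ 1)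
    (hα : ∀ t, 0 ≤ t → HasDerivWithinAt α (vectorField hK hg (α t)) (Ici 0) t) :
    IsGlobalFilamentSolution φ γ₀ fun t ξ => curve hg ξ (α t) := by
  have hc : ContinuousOn α (Ici 0) := fun t ht => (hα t ht).continuousWithinAt
  have hbd : ∀ T : ℝ, ∃ R, ∀ t ∈ Icc 0 T, ‖α t‖ ≤ R := fun T => by
    obtain ⟨R, hR⟩ := (isCompact_Icc.image_of_continuousOn
      (hc.mono (Icc_subset_Ici_self (a := T) (b := 0)))).isBounded.exists_norm_le
    exact ⟨R, fun s hs => hR _ (mem_image_of_mem _ hs)⟩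
  have hG : 0 ≤ ∫ s, ‖g s‖ := integral_nonneg fun _ => norm_nonneg _
  have hgsq : Integrable fun s => ‖g s‖ ^ 2 := hg2.integrable_norm_pow two_ne_zero
  have htm : ∀ y, MemLp (tangent g y) 2 := fun y =>
    (hg2.norm.const_mul ‖y‖).mono' (integrable_tangent hg y).1
      (Filter.Eventually.of_forall fun s => norm_tangent_le y s)
  refine ⟨fun t => tangent g (α t), fun t ht => ⟨?_, fun ξ _ => curve_eq_add_integral hg ξ _,
    (htm _).restrict _⟩, fun T _ => ?_, fun T _ => ?_, fun t ht => ?_⟩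
  · refine curve_zero_eq_curve_one hK hg (θ := fun _ => 1) (b := t) (by simp)
      (hc.mono Icc_subset_Ici_self) (fun s hs => ?_) ?_ (right_mem_Icc.2 ht)
    · rw [one_smul]
      exact (hα s hs.1).mono (Ici_subset_Ici.2 hs.1)
    · rw [hγ₀ 0 (left_mem_Icc.2 zero_le_one), hγ₀ 1 (right_mem_Icc.2 zero_le_one), hcl]
  · obtain ⟨R, hR⟩ := hbd T
    refine ⟨∫ s, R ^ 2 * ‖g s‖ ^ 2, fun t ht => ?_⟩
    have hint : Integrable fun s => ‖tangent g (α t) s‖ ^ 2 :=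
      (htm _).integrable_norm_pow two_ne_zero
    refine (setIntegral_le_integral hint
      (Filter.Eventually.of_forall fun s => by positivity)).trans
      (integral_mono hint (hgsq.const_mul _) fun s => ?_)
    have h := (norm_tangent_le (g := g) (α t) s).trans
      (mul_le_mul_of_nonneg_right (hR t ht) (norm_nonneg _))
    simpa only [mul_pow] using pow_le_pow_left₀ (norm_nonneg _) h 2
  · obtain ⟨R, hR⟩ := hbd T
    refine ⟨(1 + ∫ s, ‖g s‖) * (B * ((∫ s, ‖g s‖) * R) * (1 + R)), fun s hs t ht => ?_⟩
    have hlip := (convex_Icc 0 T).norm_image_sub_le_of_norm_hasDerivWithin_le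
      (fun τ hτ => (hα τ hτ.1).mono Icc_subset_Ici_self)
      (fun τ hτ => norm_vectorField_le hK hg (hR τ hτ)) hs ht
    rw [Real.norm_eq_abs] at hlip
    have hcurve : ∀ ξ, ‖curve hg ξ (α t) - curve hg ξ (α s)‖ ≤
        (1 + ∫ s, ‖g s‖) * (B * ((∫ s, ‖g s‖) * R) * (1 + R)) * |t - s| := fun ξ => by
      rw [← map_sub, mul_assoc]
      exact (norm_curve_le hg ξ _).trans
        (mul_le_mul_of_nonneg_left hlip (by positivity))
    refine Real.sqrt_le_iff.2 ⟨(norm_nonneg _).trans (hcurve 0), ?_⟩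
    have h := norm_setIntegral_le_of_norm_le_const (μ := volume) (s := Ioc (0:ℝ) 1) (by simp)
      (f := fun ξ => ‖curve hg ξ (α t) - curve hg ξ (α s)‖ ^ 2) (fun ξ _ => by
        rw [norm_pow, norm_norm]
        exact pow_le_pow_left₀ (norm_nonneg _) (hcurve ξ) 2)
    simpa using (le_abs_self _).trans h
  · filter_upwards [ae_restrict_mem measurableSet_Ioc] with ξ hξ
    have hξ' := Ioc_subset_Icc_self hξ
    have hc' := hc.mono (Icc_subset_Ici_self (a := t) (b := 0))
    have h := intervalIntegral.integral_eq_sub_of_hasDerivAt_of_le ht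
      (f := fun τ => curve hg ξ (α τ)) (f' := fun τ => curve hg ξ (vectorField hK hg (α τ)))
      (by fun_prop)
      (fun τ hτ => (curve hg ξ).hasFDerivAt.comp_hasDerivAt τ
        ((hα τ hτ.1.le).hasDerivAt (Ici_mem_nhds hτ.1)))
      (ContinuousOn.intervalIntegrable (by
        rw [uIcc_of_le ht]
        exact (curve hg ξ).continuous.comp_continuousOn
          ((continuous_vectorField hK hg).comp_continuousOn hc')))
    simp only [curve_vectorField hK hg _ hξ', hγ₀ ξ hξ'] at h
    exact eq_add_of_sub_eq' h.symm

end FilamentState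

/-- Global existence and uniqueness for the regularized vortex filament evolution
for any initial datum in `H¹`. -/
theorem filament_global_existence_uniqueness (φ φhat : E3 → ℝ) (hA : HypA φ φhat)
    (hφ2 : ContDiff ℝ 2 φ) (γ₀ γ₀d : ℝ → E3) (hγ₀ : IsH1Loop γ₀ γ₀d) :
    ∃ γ : ℝ → ℝ → E3, IsGlobalFilamentSolution φ γ₀ γ ∧
      ∀ γ' : ℝ → ℝ → E3, IsGlobalFilamentSolution φ γ₀ γ' →
        ∀ t : ℝ, 0 ≤ t → ∀ ξ ∈ Icc (0:ℝ) 1, γ' t ξ = γ t ξ := by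
  obtain ⟨μ, hφ⟩ := hA.exists_isCosineTransform
  obtain ⟨B, K', hK⟩ := hφ.exists_isSmoothKernel
  have hg2 : MemLp ((Ioc (0:ℝ) 1).indicator γ₀d) 2 :=
    (memLp_indicator_iff_restrict measurableSet_Ioc).2 hγ₀.memL2
  have hg : Integrable ((Ioc (0:ℝ) 1).indicator γ₀d) :=
    (integrable_indicator_iff measurableSet_Ioc).2 (hγ₀.memL2.integrable one_le_two)
  let y₀ : FilamentState :=
    (γ₀ 0, BoundedContinuousFunction.const ℝ (ContinuousLinearMap.id ℝ E3))
  have hy₀ : ∀ ξ ∈ Icc (0:ℝ) 1, FilamentState.curve hg ξ y₀ = γ₀ ξ := fun ξ hξ => by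
    rw [hγ₀.deriv_eq ξ hξ, FilamentState.curve_apply]
    congr 1
    refine intervalIntegral.integral_congr_ae (Filter.Eventually.of_forall fun s hs => ?_)
    rw [uIoc_of_le hξ.1] at hs
    exact indicator_of_mem (Ioc_subset_Ioc_right hξ.2 hs) _
  obtain ⟨α, h0, hc, hα⟩ := FilamentState.exists_forward_integralCurve hφ hK hg (y₀ := y₀) (by
    rw [hy₀ 0 (left_mem_Icc.2 zero_le_one), hy₀ 1 (right_mem_Icc.2 zero_le_one), hγ₀.closed])
  have hsol := FilamentState.isGlobalFilamentSolution hK hg hg2 (by rwa [h0]) hγ₀.closed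
    fun t ht => FilamentState.hasDerivWithinAt_Ici hK hg hc hα ht
  exact ⟨_, hsol, fun γ' h' t ht ξ hξ => h'.eq hφ hsol ht hξ⟩
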